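/- arXiv:2302.02673 — 2 statements merged into one kernel-verified Lean document; each statement's English description precedes it below -/
import Mathlib

section
/- (Edge asymptotics of the Christoffel–Darboux kernel.) Let μ > 0 and for each integer N ≥ 1 set ℏ = ℏ_N := μ/N. Let c_μ = 2^{1/2} μ^{1/6}. Then for every compact set W ⊂ ℂ² and every α, β ∈ {0,1}, there exists a constant C > 0 such that for all N ≥ 1, sup_{(t,s) ∈ W} | ∂_t^α ∂_s^β [ ℏ^{2/3} K_N(√(2μ) + ℏ^{2/3} t, √(2μ) + ℏ^{2/3} s) − c_μ K_Ai(c_μ t, c_μ s) ] | ≤ C ℏ^{1/3}, where K_N and K_Ai are extended to entire functions of (t,s) ∈ ℂ² and ∂_t, ∂_s denote complex derivatives. -/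
open MeasureTheory Filter

/-- Physicists' Hermite polynomial `h_k(y) = (-1)^k e^{y^2} (d/dy)^k e^{-y^2}`. -/
noncomputable def hermiteH (k : ℕ) (y : ℝ) : ℝ :=
  (-1)^k * Real.exp (y^2) * iteratedDeriv k (fun t => Real.exp (-t^2)) y

/-- Hermite function `ψ_k^ℏ`. -/
noncomputable def psiH (hbar : ℝ) (k : ℕ) (x : ℝ) : ℝ :=
  (Real.sqrt (Real.sqrt Real.pi * 2^k * (Nat.factorial k) * Real.sqrt hbar))⁻¹ *
    Real.exp (-x^2 / (2*hbar)) * hermiteH k (x / Real.sqrt hbar)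

/-- Kernel of the spectral projection `P_{<N}`. -/
noncomputable def KerK (hbar : ℝ) (N : ℕ) (u v : ℝ) : ℝ :=
  ∑ k ∈ Finset.range N, psiH hbar k u * psiH hbar k v

/-- Kernel of the Zeno Hamiltonian `H_N = P_{<N} p̂ P_{<N}`. -/
noncomputable def KerQ (hbar : ℝ) (N : ℕ) (u v : ℝ) : ℂ :=
  Complex.I * (Real.sqrt (hbar/2) : ℂ) *
    ∑ j ∈ Finset.range (N-1), ((Real.sqrt ((j:ℝ)+1) : ℝ) : ℂ) *
      ((psiH hbar (j+1) u * psiH hbar j v - psiH hbar j u * psiH hbar (j+1) v : ℝ) : ℂ)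

/-- Weyl symbol of `P_{<N}`. -/
noncomputable def sigmaP (hbar : ℝ) (N : ℕ) (x p : ℝ) : ℂ :=
  ∫ y : ℝ, ((hbar * KerK hbar N (x - hbar*y/2) (x + hbar*y/2) : ℝ) : ℂ) *
    Complex.exp (Complex.I * (p:ℂ) * (y:ℂ))

/-- Weyl symbol of `H_N`. -/
noncomputable def sigmaH (hbar : ℝ) (N : ℕ) (x p : ℝ) : ℂ :=
  ∫ y : ℝ, (hbar : ℂ) * KerQ hbar N (x - hbar*y/2) (x + hbar*y/2) *
    Complex.exp (Complex.I * (p:ℂ) * (y:ℂ))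
/-- Airy function via the contour integral along `Re ζ = 1`:
`Ai(z) = (1/(2πi)) ∫ e^{ζ³/3 - zζ} dζ`, parametrised by `ζ = 1 + it`. -/
noncomputable def AiryC (z : ℂ) : ℂ :=
  (1 / (2 * (Real.pi : ℂ))) *
    ∫ t : ℝ, Complex.exp ((1 + (t:ℂ)*Complex.I)^3/3 - z*(1 + (t:ℂ)*Complex.I))

/-- The Airy function on the real line (real-valued). -/
noncomputable def AiryR (x : ℝ) : ℝ := (AiryC (x:ℂ)).re

/-- Integrated Airy function `Ai₁(ξ) = ∫_ξ^∞ Ai(u) du`. -/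
noncomputable def Ai1 (ξ : ℝ) : ℝ := ∫ u in Set.Ioi ξ, AiryR u

/-- The smoothed indicator `χ_D^{(N)}(x,p) = Ai₁((2N)^{2/3}(x²+p²-2μ)/(2μ))`. -/
noncomputable def chiDN (μ : ℝ) (N : ℕ) (x p : ℝ) : ℝ :=
  Ai1 ((2*(N:ℝ)) ^ ((2:ℝ)/3) * (x^2 + p^2 - 2*μ) / (2*μ))

/-- Physicists' Hermite polynomial extended to an entire function on `ℂ`. -/
noncomputable def hermiteHC (k : ℕ) (z : ℂ) : ℂ :=
  (-1)^k * Complex.exp (z^2) * iteratedDeriv k (fun w => Complex.exp (-w^2)) z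

/-- Hermite function `ψ_k^ℏ` extended to an entire function on `ℂ`. -/
noncomputable def psiHC (hbar : ℝ) (k : ℕ) (z : ℂ) : ℂ :=
  (((Real.sqrt (Real.sqrt Real.pi * 2^k * (Nat.factorial k) * Real.sqrt hbar)) : ℂ))⁻¹ *
    Complex.exp (-z^2 / (2*(hbar:ℂ))) * hermiteHC k (z / (Real.sqrt hbar : ℂ))

/-- The Christoffel–Darboux kernel extended to `ℂ²`. -/
noncomputable def KerKC (hbar : ℝ) (N : ℕ) (u v : ℂ) : ℂ :=
  ∑ k ∈ Finset.range N, psiHC hbar k u * psiHC hbar k v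

/-- The Airy kernel `K_Ai(u,v) = ∫_0^∞ Ai(u+λ)Ai(v+λ) dλ`, as a function on `ℂ²`. -/
noncomputable def KAiryC (u v : ℂ) : ℂ :=
  ∫ l in Set.Ioi (0:ℝ), AiryC (u + (l:ℂ)) * AiryC (v + (l:ℂ))

/-- The edge constant `c_μ = 2^{1/2} μ^{1/6}`. -/
noncomputable def cEdge (μ : ℝ) : ℝ := Real.sqrt 2 * μ ^ ((1:ℝ)/6)

/-- Continuous functions with Gaussian decay. -/
def GB (φ : ℝ → ℂ) : Prop :=
  Continuous φ ∧ ∃ C κ : ℝ, 0 < κ ∧ ∀ s, ‖φ s‖ ≤ C * Real.exp (-κ * s ^ 2)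

lemma GB.integrable {φ : ℝ → ℂ} (h : GB φ) : Integrable φ := by
  obtain ⟨hc, C, κ, hκ, hb⟩ := h
  refine Integrable.mono' ((integrable_exp_neg_mul_sq hκ).const_mul C)
    hc.aestronglyMeasurable (ae_of_all _ hb)

lemma norm_affine_le (c b s : ℝ) : ‖(c : ℂ) + b * s * Complex.I‖ ≤ |c| + |b| * |s| := by
  refine (norm_add_le _ _).trans ?_
  simp

lemma GB.mul_affine {φ : ℝ → ℂ} (h : GB φ) (c b : ℝ) :
    GB (fun s => ((c : ℂ) + b * s * Complex.I) * φ s) := by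
  obtain ⟨hc, C, κ, hκ, hb⟩ := h
  refine ⟨by fun_prop, (|c| + |b| * (1 + 2 / κ)) * C, κ / 2, by positivity, fun s => ?_⟩
  rw [norm_mul]
  have h1 : |s| ≤ (1 + 2 / κ) * Real.exp (κ / 2 * s ^ 2) := by
    have e1 : κ / 2 * s ^ 2 + 1 ≤ Real.exp (κ / 2 * s ^ 2) := Real.add_one_le_exp _
    have e2 : |s| ≤ 1 + s ^ 2 := by
      nlinarith [sq_abs s, sq_nonneg (|s| - 1)]
    have e3 : s ^ 2 ≤ 2 / κ * Real.exp (κ / 2 * s ^ 2) := by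
      rw [div_mul_eq_mul_div, le_div_iff₀ hκ]; linarith
    have e4 : 1 ≤ Real.exp (κ / 2 * s ^ 2) := Real.one_le_exp (by positivity)
    linarith
  have h2 : ‖(c : ℂ) + b * s * Complex.I‖ ≤
      (|c| + |b| * (1 + 2 / κ)) * Real.exp (κ / 2 * s ^ 2) := by
    refine (norm_affine_le c b s).trans ?_
    have e4 : 1 ≤ Real.exp (κ / 2 * s ^ 2) := Real.one_le_exp (by positivity)
    have := mul_le_mul_of_nonneg_left h1 (abs_nonneg b)
    have := mul_le_mul_of_nonneg_left e4 (abs_nonneg c)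
    linarith
  calc _ ≤ ((|c| + |b| * (1 + 2 / κ)) * Real.exp (κ / 2 * s ^ 2)) * (C * Real.exp (-κ * s ^ 2)) :=
        mul_le_mul h2 (hb s) (norm_nonneg _) (by positivity)
    _ = (|c| + |b| * (1 + 2 / κ)) * C * (Real.exp (κ / 2 * s ^ 2) * Real.exp (-κ * s ^ 2)) := by ring
    _ = _ := by rw [← Real.exp_add]; congr 2; ring

lemma exp_affine_bound (c b s R κ : ℝ) (hκ : 0 < κ) (z : ℂ) (hz : ‖z‖ ≤ R) :
    ‖Complex.exp (-((c : ℂ) + b * s * Complex.I) * z)‖ * Real.exp (-κ * s ^ 2) ≤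
      Real.exp (|c| * R + (|b| * R) ^ 2 / (2 * κ)) * Real.exp (-(κ / 2) * s ^ 2) := by
  rw [Complex.norm_exp, ← Real.exp_add, ← Real.exp_add]
  apply Real.exp_le_exp.mpr
  have hR : 0 ≤ R := (norm_nonneg _).trans hz
  have h1 : (-((c : ℂ) + b * s * Complex.I) * z).re ≤ (|c| + |b| * |s|) * R := by
    refine (Complex.re_le_norm _).trans ?_
    rw [norm_mul, norm_neg]
    exact mul_le_mul (norm_affine_le c b s) hz (norm_nonneg _) (by positivity)
  have h2 : |b| * |s| * R ≤ (|b| * R) ^ 2 / (2 * κ) + κ / 2 * s ^ 2 := by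
    have : (|b| * R) ^ 2 / (2 * κ) + κ / 2 * s ^ 2 - |b| * |s| * R
        = (|b| * R - κ * |s|) ^ 2 / (2 * κ) := by
      rw [← sq_abs s]; field_simp; ring
    have h3 : 0 ≤ (|b| * R - κ * |s|) ^ 2 / (2 * κ) := by positivity
    linarith
  linarith

lemma GB.mul_exp {φ : ℝ → ℂ} (h : GB φ) (c b : ℝ) (z : ℂ) :
    GB (fun s => φ s * Complex.exp (-((c : ℂ) + b * s * Complex.I) * z)) := by
  obtain ⟨hc, C, κ, hκ, hb⟩ := h
  have hC : 0 ≤ C := by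
    have := (norm_nonneg _).trans (hb 0); simpa using this
  refine ⟨by fun_prop, C * Real.exp (|c| * ‖z‖ + (|b| * ‖z‖) ^ 2 / (2 * κ)), κ / 2, by positivity,
    fun s => ?_⟩
  rw [norm_mul]
  have := exp_affine_bound c b s ‖z‖ κ hκ z le_rfl
  calc _ ≤ (C * Real.exp (-κ * s ^ 2)) * ‖Complex.exp (-((c : ℂ) + b * s * Complex.I) * z)‖ := by
        gcongr; exact hb s
    _ = C * (‖Complex.exp (-((c : ℂ) + b * s * Complex.I) * z)‖ * Real.exp (-κ * s ^ 2)) := by ring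
    _ ≤ C * _ := mul_le_mul_of_nonneg_left this hC
    _ = _ := by ring

lemma GB.hasDerivAt {φ : ℝ → ℂ} (h : GB φ) (c b : ℝ) (z : ℂ) :
    HasDerivAt (fun z => ∫ s : ℝ, φ s * Complex.exp (-((c : ℂ) + b * s * Complex.I) * z))
      (-∫ s : ℝ, ((c : ℂ) + b * s * Complex.I) * φ s *
        Complex.exp (-((c : ℂ) + b * s * Complex.I) * z)) z := by
  have h' := h.mul_affine c b
  obtain ⟨hc, C, κ, hκ, hb⟩ := h'
  have hC : 0 ≤ C := by
    have := (norm_nonneg _).trans (hb 0); simpa using this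
  have hφ := h.1
  have key := hasDerivAt_integral_of_dominated_loc_of_deriv_le (μ := volume)
    (F := fun (z : ℂ) (s : ℝ) => φ s * Complex.exp (-((c : ℂ) + b * s * Complex.I) * z))
    (F' := fun (z : ℂ) (s : ℝ) => -(((c : ℂ) + b * s * Complex.I) * φ s *
        Complex.exp (-((c : ℂ) + b * s * Complex.I) * z)))
    (x₀ := z) (s := Metric.ball z 1)
    (bound := fun s => C * (Real.exp (|c| * (‖z‖ + 1) + (|b| * (‖z‖ + 1)) ^ 2 / (2 * κ))
      * Real.exp (-(κ / 2) * s ^ 2)))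
    (Metric.ball_mem_nhds z one_pos)
    (Eventually.of_forall fun x => by
      apply Continuous.aestronglyMeasurable; fun_prop)
    (h.mul_exp c b z).integrable
    (by apply Continuous.aestronglyMeasurable; fun_prop)
    (ae_of_all _ fun s x hx => by
      have hx' : ‖x‖ ≤ ‖z‖ + 1 := by
        have : ‖x - z‖ < 1 := by simpa [dist_eq_norm] using hx
        have := norm_le_insert' x z
        linarith
      rw [norm_neg, norm_mul]
      calc _ ≤ (C * Real.exp (-κ * s ^ 2)) * ‖Complex.exp (-((c : ℂ) + b * s * Complex.I) * x)‖ := by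
            gcongr; exact hb s
        _ = C * (‖Complex.exp (-((c : ℂ) + b * s * Complex.I) * x)‖ * Real.exp (-κ * s ^ 2)) := by ring
        _ ≤ _ := mul_le_mul_of_nonneg_left (exp_affine_bound c b s _ κ hκ x hx') hC)
    (((integrable_exp_neg_mul_sq (by positivity)).const_mul _).const_mul _)
    (ae_of_all _ fun s x hx => by
      have := (((hasDerivAt_id x).const_mul (-((c : ℂ) + b * s * Complex.I))).cexp).const_mul (φ s)
      refine this.congr_deriv ?_
      simp only [id]; ring)
  have := key.2
  rwa [integral_neg] at this

/-- Gaussian moments along a vertical line. -/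
noncomputable def Gk (c b : ℝ) (k : ℕ) (x : ℂ) : ℂ :=
  ∫ s : ℝ, (((c : ℂ) + b * s * Complex.I) ^ k * Complex.exp (((c : ℂ) + b * s * Complex.I) ^ 2)) *
    Complex.exp (-((c : ℂ) + b * s * Complex.I) * (2 * x))

lemma GB_pow (c b : ℝ) (hb : b ≠ 0) (k : ℕ) : GB (fun s : ℝ => ((c : ℂ) + b * s * Complex.I) ^ k *
    Complex.exp (((c : ℂ) + b * s * Complex.I) ^ 2)) := by
  induction k with
  | zero =>
    refine ⟨by fun_prop, Real.exp (c ^ 2), b ^ 2, by positivity, fun s => ?_⟩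
    simp only [pow_zero, one_mul]
    rw [Complex.norm_exp, ← Real.exp_add]
    apply le_of_eq
    congr 1
    simp [sq]; ring
  | succ k ih =>
    have := ih.mul_affine c b
    convert this using 2
    ring

lemma Gk_hasDerivAt (c b : ℝ) (hb : b ≠ 0) (k : ℕ) (x : ℂ) :
    HasDerivAt (Gk c b k) (-2 * Gk c b (k + 1) x) x := by
  have h1 := (GB_pow c b hb k).hasDerivAt c b (2 * x)
  have h2 := h1.comp x ((hasDerivAt_id x).const_mul 2)
  refine HasDerivAt.congr_deriv (f := Gk c b k) h2 ?_
  have e : Gk c b (k + 1) x = ∫ s : ℝ, (((c : ℂ) + b * s * Complex.I) *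
      (((c : ℂ) + b * s * Complex.I) ^ k * Complex.exp (((c : ℂ) + b * s * Complex.I) ^ 2))) *
      Complex.exp (-((c : ℂ) + b * s * Complex.I) * (2 * x)) := ?_
  · rw [e]; ring
  simp only [Gk]
  apply integral_congr_ae; refine ae_of_all _ fun s => ?_
  simp only; ring

lemma Gk_zero (c b : ℝ) (hb : 0 < b) (x : ℂ) :
    Gk c b 0 x = (Real.sqrt Real.pi / b : ℝ) * Complex.exp (-x ^ 2) := by
  have := integral_cexp_quadratic (b := -(b:ℂ)^2) (by
    have : (-(b:ℂ)^2).re = -b^2 := by simp [sq]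
    rw [this]; nlinarith [pow_pos hb 2]) (2 * c * b * Complex.I - 2 * b * Complex.I * x)
      (c ^ 2 - 2 * c * x)
  have e : Gk c b 0 x = ∫ s : ℝ, Complex.exp (-(b:ℂ) ^ 2 * s ^ 2 +
      (2 * c * b * Complex.I - 2 * b * Complex.I * x) * s + (c ^ 2 - 2 * c * x)) := by
    simp only [Gk]
    apply integral_congr_ae; refine ae_of_all _ fun s => ?_
    simp only [pow_zero, one_mul]
    rw [← Complex.exp_add]
    congr 1
    ring_nf
    simp only [Complex.I_sq]; ring
  rw [e, this]
  congr 1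
  · rw [neg_neg, show (Real.pi : ℂ) / (b:ℂ) ^ 2 = ((Real.pi / b ^ 2 : ℝ) : ℂ) by push_cast; ring,
      show (1 / 2 : ℂ) = ((1 / 2 : ℝ) : ℂ) by push_cast; ring,
      ← Complex.ofReal_cpow (by positivity)]
    congr 1
    rw [← Real.sqrt_eq_rpow, Real.sqrt_div' _ (by positivity), Real.sqrt_sq hb.le]
  · congr 1
    have hb' : (b : ℂ) ≠ 0 := by exact_mod_cast hb.ne'
    field_simp
    ring_nf
    simp only [Complex.I_sq]; ring

lemma iteratedDeriv_gauss (c b : ℝ) (hb : 0 < b) (k : ℕ) :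
    iteratedDeriv k (fun w : ℂ => Complex.exp (-w ^ 2)) =
      fun x => (b / Real.sqrt Real.pi : ℝ) * (-2) ^ k * Gk c b k x := by
  have hpi : (Real.sqrt Real.pi) ≠ 0 := by positivity
  induction k with
  | zero =>
    funext x
    rw [iteratedDeriv_zero, Gk_zero c b hb, pow_zero, mul_one, ← mul_assoc, ← Complex.ofReal_mul]
    rw [show b / Real.sqrt Real.pi * (Real.sqrt Real.pi / b) = 1 by field_simp]
    simp
  | succ k ih =>
    rw [iteratedDeriv_succ, ih]
    funext x
    rw [((Gk_hasDerivAt c b hb.ne' k x).const_mul _).deriv]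
    ring

lemma hermiteHC_eq (c b : ℝ) (hb : 0 < b) (k : ℕ) (x : ℂ) :
    hermiteHC k x = (b / Real.sqrt Real.pi : ℝ) * 2 ^ k * Complex.exp (x ^ 2) * Gk c b k x := by
  rw [hermiteHC, iteratedDeriv_gauss c b hb k]
  have : (-1 : ℂ) ^ k * (-2) ^ k = 2 ^ k := by rw [← mul_pow]; norm_num
  rw [← this]; ring

lemma gauss_contDiff : ContDiff ℂ ⊤ (fun w : ℂ => Complex.exp (-w ^ 2)) := by fun_prop

lemma hermiteHC_hasDerivAt (k : ℕ) (x : ℂ) :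
    HasDerivAt (hermiteHC k) (2 * x * hermiteHC k x - hermiteHC (k + 1) x) x := by
  have h1 : HasDerivAt (iteratedDeriv k (fun w : ℂ => Complex.exp (-w ^ 2)))
      (iteratedDeriv (k + 1) (fun w : ℂ => Complex.exp (-w ^ 2)) x) x := by
    rw [iteratedDeriv_succ]
    apply DifferentiableAt.hasDerivAt
    rw [iteratedDeriv_gauss 0 1 one_pos k]
    exact ((Gk_hasDerivAt 0 1 one_ne_zero k x).const_mul _).differentiableAt
  have h2 : HasDerivAt (fun x : ℂ => (-1) ^ k * Complex.exp (x ^ 2))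
      ((-1) ^ k * (Complex.exp (x ^ 2) * (2 * x))) x := by
    have := ((hasDerivAt_pow 2 x).cexp).const_mul ((-1 : ℂ) ^ k)
    simpa using this
  have h3 := h2.mul h1
  refine (h3.congr_deriv ?_)
  simp only [hermiteHC]; ring

lemma hermiteHC_zero (x : ℂ) : hermiteHC 0 x = 1 := by
  simp [hermiteHC, ← Complex.exp_add]

lemma hermiteHC_deriv (k : ℕ) (x : ℂ) :
    HasDerivAt (hermiteHC (k + 1)) (2 * (k + 1) * hermiteHC k x) x := by
  induction k generalizing x with
  | zero =>
    have h : hermiteHC 1 = fun x => 2 * x := by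
      funext x
      have h0 := (hermiteHC_hasDerivAt 0 x)
      have h1 : hermiteHC 0 = fun _ => 1 := funext hermiteHC_zero
      rw [h1] at h0
      have := h0.unique (hasDerivAt_const x 1)
      simp at this
      linear_combination -this
    rw [zero_add, h, hermiteHC_zero]
    simpa using (hasDerivAt_id x).const_mul 2
  | succ k ih =>
    have e : hermiteHC (k + 2) = fun x => 2 * x * hermiteHC (k + 1) x - 2 * (k + 1) * hermiteHC k x := by
      funext x
      have := (hermiteHC_hasDerivAt (k + 1) x).unique (ih x)
      linear_combination -this
    have h1 := (((hasDerivAt_id x).const_mul 2).mul (ih x)).sub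
      ((hermiteHC_hasDerivAt k x).const_mul (2 * ((k:ℂ) + 1)))
    have : hermiteHC (k + 1 + 1) = (((fun y : ℂ => 2 * id y) * hermiteHC (k + 1)) - fun x => (2 * ((k:ℂ) + 1)) * hermiteHC k x) := by
      rw [show k + 1 + 1 = k + 2 from rfl, e]; funext x; simp
    rw [this]
    refine h1.congr_deriv ?_
    push_cast; simp; ring

/-- Entire functions decaying exponentially along horizontal rays, locally uniformly. -/
def Dec (r : ℝ) (f : ℂ → ℂ) : Prop :=
  Differentiable ℂ f ∧ ∀ R : ℝ, ∃ C : ℝ, ∀ z : ℂ, ‖z‖ ≤ R → ∀ l : ℝ, 0 ≤ l →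
    ‖f (z + l)‖ ≤ C * Real.exp (-r * l)

lemma differentiable_deriv' {f : ℂ → ℂ} (hf : Differentiable ℂ f) : Differentiable ℂ (deriv f) := by
  intro z
  exact (hf.analyticAt z).deriv.differentiableAt

lemma differentiable_iteratedDeriv' {f : ℂ → ℂ} (hf : Differentiable ℂ f) (n : ℕ) :
    Differentiable ℂ (iteratedDeriv n f) := by
  induction n with
  | zero => simpa using hf
  | succ n ih => rw [iteratedDeriv_succ]; exact differentiable_deriv' ih

lemma deriv_decay {f : ℂ → ℂ} (hf : Differentiable ℂ f) {r R C : ℝ}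
    (h : ∀ z : ℂ, ‖z‖ ≤ R + 1 → ∀ l : ℝ, 0 ≤ l → ‖f (z + l)‖ ≤ C * Real.exp (-r * l)) :
    ∀ z : ℂ, ‖z‖ ≤ R → ∀ l : ℝ, 0 ≤ l → ‖deriv f (z + l)‖ ≤ C * Real.exp (-r * l) := by
  intro z hz l hl
  have := Complex.norm_deriv_le_of_forall_mem_sphere_norm_le (c := z + l) (f := f)
    (C := C * Real.exp (-r * l)) one_pos hf.diffContOnCl (fun w hw => by
      have hw' : ‖w - (z + l)‖ = 1 := by simpa [dist_eq_norm] using hw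
      have := h (w - l) (by
        have e : w - l = (w - (z + l)) + z := by ring
        rw [e]
        refine (norm_add_le _ _).trans ?_
        linarith) l hl
      simpa using this)
  simpa using this

lemma iteratedDeriv_decay {f : ℂ → ℂ} (hf : Differentiable ℂ f) (n : ℕ) {r R C : ℝ}
    (h : ∀ z : ℂ, ‖z‖ ≤ R + n → ∀ l : ℝ, 0 ≤ l → ‖f (z + l)‖ ≤ C * Real.exp (-r * l)) :
    ∀ z : ℂ, ‖z‖ ≤ R → ∀ l : ℝ, 0 ≤ l → ‖iteratedDeriv n f (z + l)‖ ≤ C * Real.exp (-r * l) := by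
  induction n generalizing R with
  | zero => simpa using h
  | succ n ih =>
    rw [iteratedDeriv_succ]
    refine deriv_decay (differentiable_iteratedDeriv' hf n) ?_
    refine ih ?_
    intro z hz
    refine h z ?_
    push_cast; linarith

lemma Dec.deriv {r : ℝ} {f : ℂ → ℂ} (h : Dec r f) : Dec r (deriv f) := by
  refine ⟨differentiable_deriv' h.1, fun R => ?_⟩
  obtain ⟨C, hC⟩ := h.2 (R + 1)
  exact ⟨C, deriv_decay h.1 hC⟩

lemma Dec.iteratedDeriv {r : ℝ} {f : ℂ → ℂ} (h : Dec r f) (n : ℕ) : Dec r (iteratedDeriv n f) := by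
  induction n with
  | zero => simpa using h
  | succ n ih => rw [iteratedDeriv_succ]; exact ih.deriv

lemma Dec.add {r : ℝ} {f g : ℂ → ℂ} (hf : Dec r f) (hg : Dec r g) : Dec r (fun z => f z + g z) := by
  refine ⟨hf.1.add hg.1, fun R => ?_⟩
  obtain ⟨C, hC⟩ := hf.2 R
  obtain ⟨D, hD⟩ := hg.2 R
  refine ⟨C + D, fun z hz l hl => (norm_add_le _ _).trans ?_⟩
  have := hC z hz l hl
  have := hD z hz l hl
  rw [add_mul]; linarith

lemma Dec.const_mul {r : ℝ} {f : ℂ → ℂ} (hf : Dec r f) (c : ℂ) : Dec r (fun z => c * f z) := by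
  refine ⟨hf.1.const_mul c, fun R => ?_⟩
  obtain ⟨C, hC⟩ := hf.2 R
  refine ⟨‖c‖ * C, fun z hz l hl => ?_⟩
  rw [norm_mul, mul_assoc]
  exact mul_le_mul_of_nonneg_left (hC z hz l hl) (norm_nonneg _)

/-- The bilinear half-line pairing. -/
noncomputable def BB (f g : ℂ → ℂ) (u v : ℂ) : ℂ :=
  ∫ l in Set.Ioi (0:ℝ), f (u + (l:ℂ)) * g (v + (l:ℂ))

lemma BB_symm (f g : ℂ → ℂ) (u v : ℂ) : BB f g u v = BB g f v u := by
  simp only [BB, mul_comm]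

lemma integrable_exp_neg_Ioi {r : ℝ} (hr : 0 < r) (C : ℝ) :
    IntegrableOn (fun l : ℝ => C * Real.exp (-r * l)) (Set.Ioi 0) :=
  (integrableOn_exp_mul_Ioi (by linarith) 0).const_mul C

lemma Dec.cont_mul {r : ℝ} {f g : ℂ → ℂ} (hf : Dec r f) (hg : Dec r g) (u v : ℂ) :
    Continuous (fun l : ℝ => f (u + (l:ℂ)) * g (v + (l:ℂ))) := by
  have h1 := hf.1.continuous
  have h2 := hg.1.continuous
  fun_prop

lemma Dec.mul_bound {r : ℝ} (hr : 0 < r) {f g : ℂ → ℂ} (hf : Dec r f) (hg : Dec r g) (R : ℝ) :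
    ∃ C, ∀ u v : ℂ, ‖u‖ ≤ R → ‖v‖ ≤ R → ∀ l : ℝ, 0 ≤ l →
      ‖f (u + (l:ℂ)) * g (v + (l:ℂ))‖ ≤ C * Real.exp (-r * l) := by
  obtain ⟨C, hC⟩ := hf.2 R
  obtain ⟨D, hD⟩ := hg.2 R
  refine ⟨|C| * |D|, fun u v hu hv l hl => ?_⟩
  have e1 : Real.exp (-r * l) ≤ 1 := Real.exp_le_one_iff.mpr (by nlinarith)
  have e0 : 0 < Real.exp (-r * l) := Real.exp_pos _
  have h1 : ‖f (u + l)‖ ≤ |C| * Real.exp (-r * l) := (hC u hu l hl).trans (by gcongr; exact le_abs_self _)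
  have h2 : ‖g (v + l)‖ ≤ |D| := (hD v hv l hl).trans (by
    calc D * Real.exp (-r * l) ≤ |D| * 1 := by gcongr; exact le_abs_self _
      _ = |D| := mul_one _)
  rw [norm_mul]
  calc _ ≤ (|C| * Real.exp (-r * l)) * |D| := by gcongr
    _ = _ := by ring

lemma Dec.integrable {r : ℝ} (hr : 0 < r) {f g : ℂ → ℂ} (hf : Dec r f) (hg : Dec r g) (u v : ℂ) :
    IntegrableOn (fun l : ℝ => f (u + (l:ℂ)) * g (v + (l:ℂ))) (Set.Ioi 0) := by
  obtain ⟨C, hC⟩ := hf.mul_bound hr hg (max ‖u‖ ‖v‖)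
  refine Integrable.mono' (integrable_exp_neg_Ioi hr C) (hf.cont_mul hg u v).aestronglyMeasurable ?_
  refine (ae_restrict_mem measurableSet_Ioi).mono fun l hl => ?_
  exact hC u v (le_max_left _ _) (le_max_right _ _) l (le_of_lt hl)

lemma BB_hasDerivAt {r : ℝ} (hr : 0 < r) {f g : ℂ → ℂ} (hf : Dec r f) (hg : Dec r g) (u v : ℂ) :
    HasDerivAt (fun v => BB f g u v) (BB f (deriv g) u v) v := by
  have hg' := hg.deriv
  obtain ⟨C, hC⟩ := hf.mul_bound hr hg' (max ‖u‖ (‖v‖ + 1))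
  refine (hasDerivAt_integral_of_dominated_loc_of_deriv_le (μ := volume.restrict (Set.Ioi (0:ℝ)))
    (F := fun (v : ℂ) (l : ℝ) => f (u + (l:ℂ)) * g (v + (l:ℂ)))
    (F' := fun (v : ℂ) (l : ℝ) => f (u + (l:ℂ)) * deriv g (v + (l:ℂ)))
    (x₀ := v) (s := Metric.ball v 1) (bound := fun l => C * Real.exp (-r * l))
    (Metric.ball_mem_nhds v one_pos)
    (Eventually.of_forall fun x => (hf.cont_mul hg u x).aestronglyMeasurable)
    (hf.integrable hr hg u v) (hf.cont_mul hg' u v).aestronglyMeasurable ?_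
    (integrable_exp_neg_Ioi hr C) ?_).2
  · refine (ae_restrict_mem measurableSet_Ioi).mono fun l hl x hx => ?_
    refine hC u x (le_max_left _ _) (le_trans ?_ (le_max_right _ _)) l (le_of_lt hl)
    have h1 : ‖x - v‖ < 1 := by simpa [dist_eq_norm] using hx
    have := norm_le_insert' x v
    linarith
  · refine ae_of_all _ fun l x hx => ?_
    have h1 := (hg.1 (x + l)).hasDerivAt.comp_add_const x (l : ℂ)
    exact h1.const_mul _

/-- The combination of pairings that describes the kernel difference. -/
noncomputable def TT (c Q : ℂ) (f₁ g₁ f₂ g₂ f₃ g₃ : ℂ → ℂ) (t s : ℂ) : ℂ :=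
  c * (Q * (BB f₁ g₁ (c * t) (c * s) + BB f₂ g₂ (c * t) (c * s)) - BB f₃ g₃ (c * t) (c * s))

lemma TT_symm (c Q : ℂ) (f₁ g₁ f₂ g₂ f₃ g₃ : ℂ → ℂ) (t s : ℂ) :
    TT c Q f₁ g₁ f₂ g₂ f₃ g₃ t s = TT c Q g₁ f₁ g₂ f₂ g₃ f₃ s t := by
  simp only [TT, BB_symm g₁, BB_symm g₂, BB_symm g₃]

lemma TT_iteratedDeriv {r : ℝ} (hr : 0 < r) (c Q : ℂ) {f₁ g₁ f₂ g₂ f₃ g₃ : ℂ → ℂ}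
    (hf₁ : Dec r f₁) (hf₂ : Dec r f₂) (hf₃ : Dec r f₃)
    (hg₁ : Dec r g₁) (hg₂ : Dec r g₂) (hg₃ : Dec r g₃) (n : ℕ) (t : ℂ) :
    iteratedDeriv n (fun s => TT c Q f₁ g₁ f₂ g₂ f₃ g₃ t s) = fun s => c ^ n *
      TT c Q f₁ (iteratedDeriv n g₁) f₂ (iteratedDeriv n g₂) f₃ (iteratedDeriv n g₃) t s := by
  induction n with
  | zero => simp
  | succ n ih =>
    rw [iteratedDeriv_succ, ih]
    funext s
    have hc : HasDerivAt (fun s : ℂ => c * s) c s := by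
      simpa using (hasDerivAt_id s).const_mul c
    have h1 := (BB_hasDerivAt hr hf₁ (hg₁.iteratedDeriv n) (c * t) (c * s)).comp s hc
    have h2 := (BB_hasDerivAt hr hf₂ (hg₂.iteratedDeriv n) (c * t) (c * s)).comp s hc
    have h3 := (BB_hasDerivAt hr hf₃ (hg₃.iteratedDeriv n) (c * t) (c * s)).comp s hc
    have h4 := ((((h1.add h2).const_mul Q).sub h3).const_mul c).const_mul (c ^ n)
    have h5 := h4.deriv
    simp only [iteratedDeriv_succ]
    refine Eq.trans ?_ (h5.trans ?_)
    · rfl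
    · simp only [TT]; ring

lemma TT_iteratedDeriv₂ {r : ℝ} (hr : 0 < r) (c Q : ℂ) {f₁ g₁ f₂ g₂ f₃ g₃ : ℂ → ℂ}
    (hf₁ : Dec r f₁) (hf₂ : Dec r f₂) (hf₃ : Dec r f₃)
    (hg₁ : Dec r g₁) (hg₂ : Dec r g₂) (hg₃ : Dec r g₃) (m n : ℕ) (t s : ℂ) :
    iteratedDeriv m (fun t => iteratedDeriv n (fun s => TT c Q f₁ g₁ f₂ g₂ f₃ g₃ t s) s) t =
      c ^ n * (c ^ m * TT c Q (iteratedDeriv m f₁) (iteratedDeriv n g₁) (iteratedDeriv m f₂)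
        (iteratedDeriv n g₂) (iteratedDeriv m f₃) (iteratedDeriv n g₃) t s) := by
  simp only [TT_iteratedDeriv hr c Q hf₁ hf₂ hf₃ hg₁ hg₂ hg₃ n]
  rw [iteratedDeriv_const_mul_field]
  congr 1
  simp only [TT_symm c Q f₁]
  rw [TT_iteratedDeriv hr c Q (hg₁.iteratedDeriv n) (hg₂.iteratedDeriv n) (hg₃.iteratedDeriv n)
    hf₁ hf₂ hf₃ m]
  simp only [TT_symm c Q (iteratedDeriv n g₁)]

/-- Unnormalised Hermite function. -/
noncomputable def UU (k : ℕ) (x : ℂ) : ℂ := Complex.exp (-x ^ 2 / 2) * hermiteHC k x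

lemma UU_hasDerivAt (k : ℕ) (x : ℂ) : HasDerivAt (UU k) (x * UU k x - UU (k + 1) x) x := by
  have h1 : HasDerivAt (fun x : ℂ => Complex.exp (-x ^ 2 / 2)) (Complex.exp (-x ^ 2 / 2) * (-x)) x := by
    have := (((hasDerivAt_pow 2 x).neg).div_const 2).cexp
    refine this.congr_deriv ?_
    simp; ring
  have h2 := h1.mul (hermiteHC_hasDerivAt k x)
  refine HasDerivAt.congr_deriv (f := UU k) h2 ?_
  simp only [UU]; ring

lemma UU_rec (k : ℕ) (x : ℂ) : UU (k + 2) x = 2 * x * UU (k + 1) x - 2 * (k + 1) * UU k x := by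
  have := (hermiteHC_hasDerivAt (k + 1) x).unique (hermiteHC_deriv k x)
  simp only [UU]
  have e : hermiteHC (k + 2) x = 2 * x * hermiteHC (k + 1) x - 2 * (k + 1) * hermiteHC k x := by
    linear_combination -this
  rw [e]; ring

lemma UU_one (x : ℂ) : UU 1 x = 2 * x * UU 0 x := by
  have h0 := (hermiteHC_hasDerivAt 0 x)
  have h1 : hermiteHC 0 = fun _ => 1 := funext hermiteHC_zero
  rw [h1] at h0
  have := h0.unique (hasDerivAt_const x 1)
  simp only [UU, hermiteHC_zero]
  simp at this
  have e : hermiteHC 1 x = 2 * x := by linear_combination -this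
  rw [e]; ring

lemma Dec_mul_id {f : ℂ → ℂ} (hf : ∀ r, Dec r f) (r : ℝ) : Dec r (fun z => z * f z) := by
  refine ⟨differentiable_id.mul (hf 0).1, fun R => ?_⟩
  obtain ⟨C, hC⟩ := (hf (r + 1)).2 R
  refine ⟨Real.exp R * C, fun z hz l hl => ?_⟩
  rw [norm_mul]
  have h1 : ‖z + l‖ ≤ Real.exp (R + l) := by
    refine (norm_add_le _ _).trans ?_
    have := Real.add_one_le_exp (R + l)
    have e : ‖(l : ℂ)‖ = l := by simp [abs_of_nonneg hl]
    linarith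
  calc _ ≤ Real.exp (R + l) * (C * Real.exp (-(r + 1) * l)) :=
        mul_le_mul h1 (hC z hz l hl) (norm_nonneg _) (Real.exp_pos _).le
    _ = Real.exp R * C * (Real.exp l * Real.exp (-(r + 1) * l)) := by rw [Real.exp_add]; ring
    _ = _ := by rw [← Real.exp_add]; congr 2; ring

lemma Dec_UU_zero (r : ℝ) : Dec r (UU 0) := by
  refine ⟨fun x => (UU_hasDerivAt 0 x).differentiableAt, fun R => ?_⟩
  refine ⟨Real.exp (R ^ 2 / 2 + (R + r) ^ 2 / 2), fun z hz l hl => ?_⟩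
  rw [UU, hermiteHC_zero, mul_one, Complex.norm_exp, ← Real.exp_add]
  apply Real.exp_le_exp.mpr
  have e : (-(z + l) ^ 2 / 2).re = -((z.re + l) ^ 2 - z.im ^ 2) / 2 := by
    rw [show (-(z + l) ^ 2 / 2 : ℂ) = ((-(1:ℝ)/2 : ℝ) : ℂ) * (z + l) ^ 2 by push_cast; ring,
      Complex.re_ofReal_mul]
    simp [sq]; ring
  rw [e]
  have h1 : |z.re| ≤ R := (Complex.abs_re_le_norm z).trans hz
  have h2 : |z.im| ≤ R := (Complex.abs_im_le_norm z).trans hz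
  have h3 : z.im ^ 2 ≤ R ^ 2 := sq_le_sq' (by linarith [neg_abs_le z.im]) (by linarith [le_abs_self z.im])
  have h4 : -R ≤ z.re := by linarith [neg_abs_le z.re]
  nlinarith [sq_nonneg (l - (R + r)), mul_nonneg hl (by linarith : 0 ≤ z.re + R), sq_nonneg z.re]

lemma Dec_UU (k : ℕ) (r : ℝ) : Dec r (UU k) := by
  induction k generalizing r with
  | zero => exact Dec_UU_zero r
  | succ k ih =>
    have e : UU (k + 1) = fun x => x * UU k x + (-1) * deriv (UU k) x := by
      funext x; rw [(UU_hasDerivAt k x).deriv]; ring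
    rw [e]
    exact (Dec_mul_id ih r).add ((ih r).deriv.const_mul _)

/-- Rescaled version. -/
noncomputable def VV (x0 a : ℝ) (k : ℕ) (z : ℂ) : ℂ := UU k (x0 + a * z)

lemma Dec_VV (x0 a : ℝ) (ha : 0 < a) (k : ℕ) (r : ℝ) : Dec r (VV x0 a k) := by
  have hU := (Dec_UU k (r / a))
  have h1 := hU.1
  refine ⟨?_, fun R => ?_⟩
  · unfold VV; fun_prop
  obtain ⟨C, hC⟩ := hU.2 (|x0| + a * R)
  refine ⟨C, fun z hz l hl => ?_⟩
  have := hC (x0 + a * z) (by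
    refine (norm_add_le _ _).trans ?_
    rw [norm_mul]
    simp only [Complex.norm_real, Real.norm_eq_abs, abs_of_pos ha]
    gcongr) (a * l) (by positivity)
  rw [VV]
  rw [show -(r / a) * (a * l) = -r * l by field_simp] at this
  convert this using 3
  push_cast; ring

/-- Weights. -/
noncomputable def ww (k : ℕ) : ℝ := (Real.sqrt Real.pi * 2 ^ k * (Nat.factorial k))⁻¹

lemma ww_succ (k : ℕ) : ww (k + 1) * (k + 1) = ww k / 2 := by
  have : Real.sqrt Real.pi ≠ 0 := by positivity
  have : (Nat.factorial k : ℝ) ≠ 0 := by positivity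
  have : ((k:ℝ) + 1) ≠ 0 := by positivity
  unfold ww
  rw [Nat.factorial_succ, pow_succ]
  push_cast
  field_simp

lemma CD_deriv (n : ℕ) (X Y : ℂ) :
    ∑ k ∈ Finset.range (n + 1), (ww k : ℂ) * ((X * UU k X - UU (k + 1) X) * UU k Y +
      UU k X * (Y * UU k Y - UU (k + 1) Y)) =
    -((ww n : ℂ) / 2) * (UU (n + 1) X * UU n Y + UU n X * UU (n + 1) Y) := by
  induction n with
  | zero =>
    simp [UU_one]; ring
  | succ n ih =>
    rw [Finset.sum_range_succ, ih]
    have hw : (ww (n + 1) : ℂ) * (n + 1) = ww n / 2 := by exact_mod_cast ww_succ n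
    rw [show n + 1 + 1 = n + 2 from rfl, ← hw, UU_rec n X, UU_rec n Y]
    ring

lemma Dec.tendsto {r : ℝ} (hr : 0 < r) {f g : ℂ → ℂ} (hf : Dec r f) (hg : Dec r g) (u v : ℂ) :
    Tendsto (fun l : ℝ => f (u + (l:ℂ)) * g (v + (l:ℂ))) atTop (nhds 0) := by
  obtain ⟨C, hC⟩ := hf.mul_bound hr hg (max ‖u‖ ‖v‖)
  have h1 : Tendsto (fun l : ℝ => C * Real.exp (-r * l)) atTop (nhds 0) := by
    have : Tendsto (fun l : ℝ => -r * l) atTop atBot :=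
      tendsto_id.const_mul_atTop_of_neg (by linarith)
    simpa using (Real.tendsto_exp_atBot.comp this).const_mul C
  refine squeeze_zero_norm' ?_ h1
  filter_upwards [eventually_ge_atTop 0] with l hl
  exact hC u v (le_max_left _ _) (le_max_right _ _) l hl

lemma CD_integral (x0 a : ℝ) (ha : 0 < a) (n : ℕ) (t s : ℂ) :
    ∑ k ∈ Finset.range (n + 1), (ww k : ℂ) * (VV x0 a k t * VV x0 a k s) =
    (a * ww n / 2 : ℂ) * (BB (VV x0 a (n + 1)) (VV x0 a n) t s +
      BB (VV x0 a n) (VV x0 a (n + 1)) t s) := by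
  have hD := fun k => Dec_VV x0 a ha k 1
  have hderV : ∀ (k : ℕ) (z : ℂ) (l : ℝ), HasDerivAt (fun l : ℝ => VV x0 a k (z + l))
      (a * ((x0 + a * (z + l)) * VV x0 a k (z + l) - VV x0 a (k + 1) (z + l))) l := by
    intro k z l
    have h1 : HasDerivAt (fun w : ℂ => (x0 : ℂ) + a * (z + w)) a (l : ℂ) := by
      simpa using (((hasDerivAt_id (l:ℂ)).const_add z).const_mul (a:ℂ)).const_add (x0:ℂ)
    have h2 := (UU_hasDerivAt k ((x0 : ℂ) + a * (z + l))).comp (l : ℂ) h1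
    refine HasDerivAt.congr_deriv (f := fun l : ℝ => VV x0 a k (z + l)) (h2.comp_ofReal) ?_
    simp only [VV]; ring
  have hi1 := (hD (n + 1)).integrable one_pos (hD n) t s
  have hi2 := (hD n).integrable one_pos (hD (n + 1)) t s
  have key := integral_Ioi_of_hasDerivAt_of_tendsto' (a := 0) (m := 0)
    (f := fun l : ℝ => ∑ k ∈ Finset.range (n + 1), (ww k : ℂ) * (VV x0 a k (t + l) * VV x0 a k (s + l)))
    (f' := fun l : ℝ => -(a * ww n / 2 : ℂ) * (VV x0 a (n + 1) (t + l) * VV x0 a n (s + l) +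
      VV x0 a n (t + l) * VV x0 a (n + 1) (s + l)))
    (fun l _ => by
      have := HasDerivAt.fun_sum (u := Finset.range (n + 1)) (fun k _ =>
        ((hderV k t l).mul (hderV k s l)).const_mul (ww k : ℂ))
      refine this.congr_deriv ?_
      have h := CD_deriv n (x0 + a * (t + l)) (x0 + a * (s + l))
      have h' := congrArg (fun z => (a : ℂ) * z) h
      simp only [Finset.mul_sum] at h'
      refine Eq.trans ?_ (h'.trans ?_)
      · refine Finset.sum_congr rfl fun k _ => ?_
        simp only [VV]; ring
      · simp only [VV]; ring)
    ((hi1.add hi2).const_mul _)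
    (by
      have := tendsto_finsetSum (Finset.range (n + 1)) (fun k _ =>
        ((hD k).tendsto one_pos (hD k) t s).const_mul (ww k : ℂ))
      simpa using this)
  rw [integral_const_mul, integral_add hi1 hi2] at key
  simp only [BB]
  simp only [Complex.ofReal_zero, add_zero] at key
  linear_combination key

lemma exp_sub_exp_le {a b : ℂ} {M : ℝ} (ha : a.re ≤ M) (hb : b.re ≤ M) :
    ‖Complex.exp a - Complex.exp b‖ ≤ Real.exp M * ‖a - b‖ := by
  have hconv : Convex ℝ {z : ℂ | z.re ≤ M} := convex_halfSpace_re_le M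
  exact hconv.norm_image_sub_le_of_norm_hasDerivWithin_le (f := Complex.exp) (f' := Complex.exp)
    (fun x _ => (Complex.hasDerivAt_exp x).hasDerivWithinAt)
    (fun x hx => by rw [Complex.norm_exp]; exact Real.exp_le_exp.mpr hx) hb ha

lemma log_taylor_bound {e : ℂ} (he : 0 ≤ e.re) :
    ‖Complex.log (1 + e) - e + e ^ 2 / 2 - e ^ 3 / 3‖ ≤ ‖e‖ ^ 4 := by
  have hconv : Convex ℝ ({z : ℂ | 0 ≤ z.re} ∩ Metric.closedBall 0 ‖e‖) :=
    (convex_halfSpace_re_ge 0).inter (convex_closedBall _ _)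
  have hne : ∀ x : ℂ, 0 ≤ x.re → 1 + x ≠ 0 := by
    intro x hx h
    have := congrArg Complex.re h
    simp at this; linarith
  have h := hconv.norm_image_sub_le_of_norm_hasDerivWithin_le
    (f := fun z : ℂ => Complex.log (1 + z) - z + z ^ 2 / 2 - z ^ 3 / 3)
    (f' := fun z => -z ^ 3 / (1 + z)) (C := ‖e‖ ^ 3) (x := 0) (y := e)
    (fun x hx => by
      have hs : 1 + x ∈ Complex.slitPlane := by
        left; simp; linarith [hx.1.out]
      have h1 := ((hasDerivAt_id x).const_add 1).clog hs
      have h2 := ((h1.sub (hasDerivAt_id x)).add ((hasDerivAt_pow 2 x).div_const 2)).sub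
        ((hasDerivAt_pow 3 x).div_const 3)
      refine HasDerivAt.hasDerivWithinAt (h2.congr_deriv ?_)
      have := hne x hx.1
      simp
      field_simp; ring)
    (fun x hx => by
      have hx1 : 0 ≤ x.re := hx.1
      have hx2 : ‖x‖ ≤ ‖e‖ := by simpa using hx.2
      have h3 : 1 ≤ ‖1 + x‖ := by
        refine le_trans ?_ (Complex.re_le_norm _)
        simp [hx1]
      rw [norm_div, norm_neg, norm_pow]
      rw [div_le_iff₀ (by linarith)]
      calc ‖x‖ ^ 3 ≤ ‖e‖ ^ 3 := by gcongr
        _ ≤ ‖e‖ ^ 3 * ‖1 + x‖ := le_mul_of_one_le_right (by positivity) h3)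
    (by simp) (by simp [he])
  simp at h
  calc _ ≤ _ := h
    _ = _ := by ring

/-- The weight in the integral representation. -/
noncomputable def fp (d : ℝ) (N p : ℕ) (η : ℂ) : ℂ :=
  (1 + d * η) ^ p * Complex.exp (N * (-(d * η) + (d * η) ^ 2 / 2))

/-- Rescaled Hermite functions. -/
noncomputable def JJ (d : ℝ) (N p : ℕ) (A : ℝ) (T : ℂ) : ℂ :=
  Complex.exp (T ^ 2 * d / 4) * (1 / (2 * (Real.pi : ℂ)) *
    ∫ s : ℝ, fp d N p ((A:ℂ) + s * Complex.I) * Complex.exp (-((A:ℂ) + s * Complex.I) * T))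

lemma fp_norm (d : ℝ) (hd : 0 < d) (N : ℕ) (A s : ℝ) (hA : 0 < A) :
    ‖fp d N N ((A:ℂ) + s * Complex.I)‖ ≤ Real.exp (N * (Real.log (1 + d * A) - d * A + (d * A) ^ 2 / 2)
      - N * d ^ 2 * s ^ 2 / 2 * (1 - 1 / (1 + d * A) ^ 2)) := by
  have ha : 0 < d * A := by positivity
  set a := d * A with ha'
  have h1 : ‖1 + (d:ℂ) * ((A:ℂ) + s * Complex.I)‖ ≤ Real.exp (Real.log (1 + a) + (d * s) ^ 2 / (2 * (1 + a) ^ 2)) := by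
    rw [Real.exp_add, Real.exp_log (by positivity)]
    refine le_of_sq_le_sq ?_ (by positivity)
    rw [← Complex.normSq_eq_norm_sq, Complex.normSq_apply, mul_pow, ← Real.exp_nat_mul]
    have e1 : (2:ℕ) * ((d * s) ^ 2 / (2 * (1 + a) ^ 2)) = (d * s) ^ 2 / (1 + a) ^ 2 := by
      push_cast; field_simp
    rw [e1]
    have e2 := Real.add_one_le_exp ((d * s) ^ 2 / (1 + a) ^ 2)
    have e3 : (1 + a) ^ 2 * ((d * s) ^ 2 / (1 + a) ^ 2 + 1) = (d * s) ^ 2 + (1 + a) ^ 2 := by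
      field_simp
    have e4 := mul_le_mul_of_nonneg_left e2 (by positivity : 0 ≤ (1 + a) ^ 2)
    rw [e3] at e4
    refine le_trans (le_of_eq ?_) e4
    simp [ha']; ring
  have h2 : ((N:ℂ) * (-(d * ((A:ℂ) + s * Complex.I)) + (d * ((A:ℂ) + s * Complex.I)) ^ 2 / 2)).re
      = N * (-a + (a ^ 2 - (d * s) ^ 2) / 2) := by
    rw [show ((N:ℂ) * (-(d * ((A:ℂ) + s * Complex.I)) + (d * ((A:ℂ) + s * Complex.I)) ^ 2 / 2))
      = ((N:ℝ):ℂ) * (-(d * ((A:ℂ) + s * Complex.I)) + ((1/2:ℝ):ℂ) * (d * ((A:ℂ) + s * Complex.I)) ^ 2) by push_cast; ring]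
    rw [Complex.re_ofReal_mul, Complex.add_re, Complex.re_ofReal_mul]
    congr 1
    simp [sq, ha']; ring
  rw [fp, norm_mul, norm_pow, Complex.norm_exp, h2]
  calc _ ≤ Real.exp (Real.log (1 + a) + (d * s) ^ 2 / (2 * (1 + a) ^ 2)) ^ N * Real.exp (N * (-a + (a ^ 2 - (d * s) ^ 2) / 2)) := by
        gcongr
    _ = _ := by
        rw [← Real.exp_nat_mul, ← Real.exp_add]
        congr 1
        field_simp; ring

lemma one_le_zeta (d : ℝ) (hd : 0 < d) (A s : ℝ) (hA : 0 < A) :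
    1 ≤ ‖1 + (d:ℂ) * ((A:ℂ) + s * Complex.I)‖ := by
  refine le_trans ?_ (Complex.re_le_norm _)
  simp; positivity

lemma fp_le (d : ℝ) (hd : 0 < d) (N p : ℕ) (hp : p = N ∨ p + 1 = N) (A s : ℝ) (hA : 0 < A) :
    ‖fp d N p ((A:ℂ) + s * Complex.I)‖ ≤ ‖fp d N N ((A:ℂ) + s * Complex.I)‖ := by
  rw [fp, fp, norm_mul, norm_mul, norm_pow, norm_pow]
  gcongr
  · exact one_le_zeta d hd A s hA
  · omega

lemma fp_sub (d : ℝ) (hd : 0 < d) (N p : ℕ) (hp : p = N ∨ p + 1 = N) (A s : ℝ) (hA : 0 < A) :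
    ‖fp d N p ((A:ℂ) + s * Complex.I) - fp d N N ((A:ℂ) + s * Complex.I)‖ ≤
      d * ‖(A:ℂ) + s * Complex.I‖ * ‖fp d N N ((A:ℂ) + s * Complex.I)‖ := by
  have hle := fp_le d hd N p hp A s hA
  rcases hp with rfl | rfl
  · simp; positivity
  · set η := (A:ℂ) + s * Complex.I
    have e : fp d (p + 1) p η - fp d (p + 1) (p + 1) η = -(d * η) * fp d (p + 1) p η := by
      simp only [fp]; ring
    rw [e, norm_mul, norm_neg, norm_mul]
    simp only [Complex.norm_real, Real.norm_eq_abs, abs_of_pos hd]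
    gcongr

lemma fp_norm_one (d : ℝ) (hd : 0 < d) (hd1 : d ≤ 1) (N : ℕ) (hN : N * d ^ 3 = 1) (s : ℝ) :
    ‖fp d N N (((1:ℝ):ℂ) + s * Complex.I)‖ ≤ Real.exp (4 / 3 - s ^ 2 / 4) := by
  refine (fp_norm d hd N 1 s one_pos).trans (Real.exp_le_exp.mpr ?_)
  rw [mul_one]
  have h1 : Real.log (1 + d) - d + d ^ 2 / 2 - d ^ 3 / 3 ≤ d ^ 4 := by
    have h := log_taylor_bound (e := (d:ℂ)) (by simp [hd.le])
    have e : Complex.log (1 + (d:ℂ)) - d + (d:ℂ) ^ 2 / 2 - (d:ℂ) ^ 3 / 3 =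
        ((Real.log (1 + d) - d + d ^ 2 / 2 - d ^ 3 / 3 : ℝ) : ℂ) := by
      push_cast
      rw [Complex.ofReal_log (by positivity)]
      push_cast; ring
    rw [e] at h
    simp only [Complex.norm_real, Real.norm_eq_abs, abs_of_pos hd] at h
    exact (le_abs_self _).trans h
  have hN0 : (0:ℝ) ≤ N := Nat.cast_nonneg N
  have h2 : N * (Real.log (1 + d) - d + d ^ 2 / 2) ≤ 4 / 3 := by
    have := mul_le_mul_of_nonneg_left h1 hN0
    have e : (N:ℝ) * d ^ 4 = d := by
      calc (N:ℝ) * d ^ 4 = (N * d ^ 3) * d := by ring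
        _ = d := by rw [hN, one_mul]
    rw [e] at this
    nlinarith
  have h3 : d / 2 ≤ 1 - 1 / (1 + d) ^ 2 := by
    have : 1 / (1 + d) ^ 2 ≤ 1 - d / 2 := by
      rw [div_le_iff₀ (by positivity)]
      nlinarith [mul_nonneg hd.le (sub_nonneg.mpr hd1), mul_nonneg (mul_nonneg hd.le hd.le) (sub_nonneg.mpr hd1)]
    linarith
  have h4 : s ^ 2 / 4 ≤ N * d ^ 2 * s ^ 2 / 2 * (1 - 1 / (1 + d) ^ 2) := by
    calc s ^ 2 / 4 = (N * d ^ 3) * s ^ 2 / 4 := by rw [hN, one_mul]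
      _ = N * d ^ 2 * s ^ 2 / 2 * (d / 2) := by ring
      _ ≤ _ := by gcongr
  linarith

lemma airy_re (s : ℝ) : ((((1:ℝ):ℂ) + s * Complex.I) ^ 3 / 3).re = 1 / 3 - s ^ 2 := by
  rw [show (((1:ℝ):ℂ) + s * Complex.I) ^ 3 / 3 = ((1/3:ℝ):ℂ) * (((1:ℝ):ℂ) + s * Complex.I) ^ 3 by push_cast; ring,
    Complex.re_ofReal_mul]
  simp [pow_succ]; ring

lemma fp_airy (d : ℝ) (hd : 0 < d) (hd1 : d ≤ 1) (N : ℕ) (hN : N * d ^ 3 = 1) (s : ℝ) :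
    ‖fp d N N (((1:ℝ):ℂ) + s * Complex.I) - Complex.exp ((((1:ℝ):ℂ) + s * Complex.I) ^ 3 / 3)‖ ≤
      Real.exp (4 / 3 - s ^ 2 / 4) * (d * ‖((1:ℝ):ℂ) + s * Complex.I‖ ^ 4) := by
  have hb := fp_norm_one d hd hd1 N hN s
  have hz := one_le_zeta d hd 1 s one_pos
  have hre := airy_re s
  have hη : 0 ≤ ((d:ℂ) * (((1:ℝ):ℂ) + s * Complex.I)).re := by simp [hd.le]
  set η := ((1:ℝ):ℂ) + s * Complex.I with hη'
  have hne : 1 + (d:ℂ) * η ≠ 0 := by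
    intro h; rw [h] at hz; simp at hz; linarith
  have e : fp d N N η = Complex.exp (N * (Complex.log (1 + d * η) - d * η + (d * η) ^ 2 / 2)) := by
    rw [fp]
    conv_lhs => rw [← Complex.exp_log hne]
    rw [← Complex.exp_nat_mul, ← Complex.exp_add]
    congr 1
    ring
  rw [e] at hb ⊢
  rw [Complex.norm_exp, Real.exp_le_exp] at hb
  refine (exp_sub_exp_le hb (by rw [hre]; nlinarith [sq_nonneg s])).trans ?_
  gcongr
  have hNc : (N:ℂ) * (d:ℂ) ^ 3 = 1 := by exact_mod_cast hN
  have e2 : (N:ℂ) * (Complex.log (1 + d * η) - d * η + (d * η) ^ 2 / 2) - η ^ 3 / 3 =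
      N * (Complex.log (1 + d * η) - d * η + (d * η) ^ 2 / 2 - (d * η) ^ 3 / 3) := by
    linear_combination (η ^ 3 / 3) * hNc
  rw [e2, norm_mul]
  have h5 := log_taylor_bound hη
  calc _ ≤ ‖(N:ℂ)‖ * ‖(d:ℂ) * η‖ ^ 4 := by gcongr
    _ = (N * d ^ 3) * (d * ‖η‖ ^ 4) := by
        rw [norm_mul]
        simp only [Complex.norm_real, Real.norm_eq_abs, abs_of_pos hd, Complex.norm_natCast]
        ring
    _ = _ := by rw [hN, one_mul]

lemma norm_exp_eta (A s R l : ℝ) (hA : 0 < A) (z : ℂ) (hz : ‖z‖ ≤ R) :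
    ‖Complex.exp (-((A:ℂ) + s * Complex.I) * (z + l))‖ ≤ Real.exp (A * R - A * l + |s| * R) := by
  rw [Complex.norm_exp, Real.exp_le_exp]
  have e : (-((A:ℂ) + s * Complex.I) * (z + l)).re = -A * (z.re + l) + s * z.im := by
    simp
  rw [e]
  have h1 : |z.re| ≤ R := (Complex.abs_re_le_norm z).trans hz
  have h2 : |z.im| ≤ R := (Complex.abs_im_le_norm z).trans hz
  have h3 : s * z.im ≤ |s| * R := by
    calc s * z.im ≤ |s * z.im| := le_abs_self _
      _ = |s| * |z.im| := abs_mul _ _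
      _ ≤ _ := by gcongr
  have h4 : -R ≤ z.re := by linarith [neg_abs_le z.re]
  nlinarith

lemma absorb (s D : ℝ) : -s ^ 2 / 4 + D * |s| ≤ -(1 / 8) * s ^ 2 + 2 * D ^ 2 := by
  rw [← sq_abs s]
  nlinarith [sq_nonneg (|s| - 4 * D)]

lemma AiryC_eq (z : ℂ) : AiryC z = 1 / (2 * (Real.pi : ℂ)) *
    ∫ s : ℝ, Complex.exp ((((1:ℝ):ℂ) + s * Complex.I) ^ 3 / 3) *
      Complex.exp (-(((1:ℝ):ℂ) + s * Complex.I) * z) := by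
  rw [AiryC]
  congr 1
  apply integral_congr_ae; refine ae_of_all _ fun s => ?_
  simp only
  rw [← Complex.exp_add]
  congr 1
  push_cast; ring

lemma GB_airy : GB (fun s : ℝ => Complex.exp ((((1:ℝ):ℂ) + s * Complex.I) ^ 3 / 3)) := by
  refine ⟨by fun_prop, Real.exp (1 / 3), 1, one_pos, fun s => ?_⟩
  rw [Complex.norm_exp, airy_re, ← Real.exp_add]
  apply le_of_eq; congr 1; ring

lemma AiryC_differentiable : Differentiable ℂ AiryC := by
  intro z
  have h := (GB_airy.hasDerivAt 1 1 z).const_mul (1 / (2 * (Real.pi : ℂ)))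
  have e : AiryC = fun z => 1 / (2 * (Real.pi : ℂ)) *
    ∫ s : ℝ, Complex.exp ((((1:ℝ):ℂ) + s * Complex.I) ^ 3 / 3) *
      Complex.exp (-(((1:ℝ):ℂ) + ((1:ℝ):ℂ) * s * Complex.I) * z) := by
    funext z; rw [AiryC_eq]; simp
  rw [e]
  exact h.differentiableAt

lemma airy_pointwise (s R l : ℝ) (z : ℂ) (hz : ‖z‖ ≤ R) :
    ‖Complex.exp ((((1:ℝ):ℂ) + s * Complex.I) ^ 3 / 3) *
      Complex.exp (-(((1:ℝ):ℂ) + s * Complex.I) * (z + l))‖ ≤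
    Real.exp (1 / 3 + R + 2 * R ^ 2) * Real.exp (-l) * Real.exp (-(1 / 8) * s ^ 2) := by
  rw [norm_mul]
  have h1 := norm_exp_eta 1 s R l one_pos z hz
  have h2 := absorb s R
  calc _ ≤ Real.exp (1 / 3 - s ^ 2) * Real.exp (1 * R - 1 * l + |s| * R) := by
        gcongr
        rw [Complex.norm_exp, airy_re]
    _ ≤ _ := by
        rw [← Real.exp_add, ← Real.exp_add, ← Real.exp_add, Real.exp_le_exp]
        nlinarith [sq_nonneg s]

/-- A Gaussian constant. -/
noncomputable def G0 : ℝ := ∫ s : ℝ, Real.exp (-(1 / 8) * s ^ 2)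

lemma G0_nonneg : 0 ≤ G0 := integral_nonneg fun _ => (Real.exp_pos _).le

lemma int_bound {f : ℝ → ℂ} {C : ℝ} (hf : ∀ s, ‖f s‖ ≤ C * Real.exp (-(1 / 8) * s ^ 2)) :
    ‖1 / (2 * (Real.pi : ℂ)) * ∫ s : ℝ, f s‖ ≤ C * G0 := by
  have h1 : ‖∫ s : ℝ, f s‖ ≤ C * G0 := by
    rw [G0, ← integral_const_mul]
    exact norm_integral_le_of_norm_le
      ((integrable_exp_neg_mul_sq (by norm_num)).const_mul C) (ae_of_all _ hf)
  have h2 : ‖1 / (2 * (Real.pi : ℂ))‖ ≤ 1 := by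
    rw [show 1 / (2 * (Real.pi : ℂ)) = ((1 / (2 * Real.pi) : ℝ) : ℂ) by push_cast; ring]
    rw [Complex.norm_real, Real.norm_eq_abs, abs_of_pos (by positivity)]
    rw [div_le_one (by positivity)]
    linarith [Real.pi_gt_three]
  rw [norm_mul]
  calc _ ≤ 1 * (C * G0) := by gcongr
    _ = _ := one_mul _

lemma AiryC_bound (R l : ℝ) (z : ℂ) (hz : ‖z‖ ≤ R) :
    ‖AiryC (z + l)‖ ≤ Real.exp (1 / 3 + R + 2 * R ^ 2) * G0 * Real.exp (-l) := by
  rw [AiryC_eq]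
  refine (int_bound (fun s => airy_pointwise s R l z hz)).trans (le_of_eq (by ring))

lemma Dec_AiryC : Dec (1 / 32) AiryC := by
  refine ⟨AiryC_differentiable, fun R => ⟨Real.exp (1 / 3 + R + 2 * R ^ 2) * G0, fun z hz l hl => ?_⟩⟩
  refine (AiryC_bound R l z hz).trans ?_
  have := G0_nonneg
  gcongr
  linarith

lemma GB_fp (d : ℝ) (hd : 0 < d) (hd1 : d ≤ 1) (N p : ℕ) (hN : N * d ^ 3 = 1)
    (hp : p = N ∨ p + 1 = N) : GB (fun s : ℝ => fp d N p (((1:ℝ):ℂ) + s * Complex.I)) := by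
  refine ⟨by unfold fp; fun_prop, Real.exp (4 / 3), 1 / 4, by norm_num, fun s => ?_⟩
  refine (fp_le d hd N p hp 1 s one_pos).trans ((fp_norm_one d hd hd1 N hN s).trans (le_of_eq ?_))
  rw [← Real.exp_add]; congr 1; ring

/-- Constant of the near region. -/
noncomputable def C1 (R : ℝ) : ℝ :=
  (8 * Real.exp (R / 4 + (R ^ 2 + 2 * R) / 4) + 1 + 24) *
    Real.exp (4 / 3 + 1 + R + 2 * (R + 1) ^ 2)

lemma near_pointwise (d : ℝ) (hd : 0 < d) (hd1 : d ≤ 1) (N p : ℕ) (hN : N * d ^ 3 = 1)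
    (hp : p = N ∨ p + 1 = N) (s R l : ℝ) (z : ℂ) (hz : ‖z‖ ≤ R) (hl : 0 ≤ l) (hld : l * d ≤ 1) :
    ‖Complex.exp ((z + l) ^ 2 * d / 4) * (fp d N p (((1:ℝ):ℂ) + s * Complex.I) *
        Complex.exp (-(((1:ℝ):ℂ) + s * Complex.I) * (z + l))) -
      Complex.exp ((((1:ℝ):ℂ) + s * Complex.I) ^ 3 / 3) *
        Complex.exp (-(((1:ℝ):ℂ) + s * Complex.I) * (z + l))‖ ≤
    C1 R * (d * Real.exp (-l / 2)) * Real.exp (-(1 / 8) * s ^ 2) := by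
  have hR : 0 ≤ R := (norm_nonneg z).trans hz
  have hη1 : ‖((1:ℝ):ℂ) + s * Complex.I‖ ≤ 1 + |s| := by
    refine (norm_add_le _ _).trans ?_; simp
  have hexp := norm_exp_eta 1 s R l one_pos z hz
  have hle := fp_le d hd N p hp 1 s one_pos
  have hsub := fp_sub d hd N p hp 1 s one_pos
  have hone := fp_norm_one d hd hd1 N hN s
  have hai := fp_airy d hd hd1 N hN s
  set η := ((1:ℝ):ℂ) + s * Complex.I with hη'
  set M := 4 / 3 - s ^ 2 / 4 with hM
  have hT : ‖z + l‖ ≤ R + l := by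
    refine (norm_add_le _ _).trans ?_
    have e : ‖(l : ℂ)‖ = l := by simp [abs_of_nonneg hl]
    linarith
  -- the quadratic factor
  have hq : ‖Complex.exp ((z + l) ^ 2 * d / 4) - 1‖ ≤
      d * (8 * Real.exp (R / 4 + (R ^ 2 + 2 * R) / 4) * Real.exp (l / 2)) := by
    have hn : ‖(z + l) ^ 2 * d / 4‖ ≤ d * ((R + l) ^ 2 / 4) := by
      rw [norm_div, norm_mul, norm_pow]
      simp only [Complex.norm_real, Real.norm_eq_abs, abs_of_pos hd, Complex.norm_ofNat]
      calc ‖z + l‖ ^ 2 * d / 4 ≤ (R + l) ^ 2 * d / 4 := by gcongr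
        _ = _ := by ring
    have hn2 : d * ((R + l) ^ 2 / 4) ≤ (R ^ 2 + 2 * R + l) / 4 := by
      have a1 : d * R ^ 2 ≤ R ^ 2 := by nlinarith [sq_nonneg R]
      have a2 : R * (l * d) ≤ R := by nlinarith
      have a3 : l * (l * d) ≤ l := by nlinarith
      nlinarith
    have hx := exp_sub_exp_le (a := (z + l) ^ 2 * d / 4) (b := 0) (M := (R ^ 2 + 2 * R + l) / 4)
      ((Complex.re_le_norm _).trans (hn.trans hn2)) (by simp; positivity)
    rw [Complex.exp_zero, sub_zero] at hx
    have h8 : (R + l) ^ 2 / 4 ≤ 8 * Real.exp ((R + l) / 4) := by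
      have := Real.quadratic_le_exp_of_nonneg (by positivity : 0 ≤ (R + l) / 4)
      nlinarith
    calc _ ≤ _ := hx
      _ ≤ Real.exp ((R ^ 2 + 2 * R + l) / 4) * (d * (8 * Real.exp ((R + l) / 4))) := by
          gcongr
          exact hn.trans (by gcongr)
      _ = d * (8 * (Real.exp ((R ^ 2 + 2 * R + l) / 4) * Real.exp ((R + l) / 4))) := by ring
      _ = d * (8 * (Real.exp (R / 4 + (R ^ 2 + 2 * R) / 4) * Real.exp (l / 2))) := by
          rw [← Real.exp_add, ← Real.exp_add]; congr 3; ring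
      _ = _ := by ring
  set K := 8 * Real.exp (R / 4 + (R ^ 2 + 2 * R) / 4) with hK
  have hKpos : 0 < K := by positivity
  have hmain : ‖Complex.exp ((z + l) ^ 2 * d / 4) * fp d N p η - Complex.exp (η ^ 3 / 3)‖ ≤
      d * Real.exp M * Real.exp (l / 2) * ((K + 1 + 24) * Real.exp (1 + |s|)) := by
    have e : Complex.exp ((z + l) ^ 2 * d / 4) * fp d N p η - Complex.exp (η ^ 3 / 3) =
      (Complex.exp ((z + l) ^ 2 * d / 4) - 1) * fp d N p η + (fp d N p η - fp d N N η) +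
      (fp d N N η - Complex.exp (η ^ 3 / 3)) := by ring
    rw [e]
    have t1 : ‖(Complex.exp ((z + l) ^ 2 * d / 4) - 1) * fp d N p η‖ ≤
        d * (K * Real.exp (l / 2)) * Real.exp M := by
      rw [norm_mul]
      exact mul_le_mul hq (hle.trans hone) (norm_nonneg _) (by positivity)
    have t2 : ‖fp d N p η - fp d N N η‖ ≤ d * (1 + |s|) * Real.exp M := by
      refine hsub.trans ?_
      gcongr
    have t3 : ‖fp d N N η - Complex.exp (η ^ 3 / 3)‖ ≤ Real.exp M * (d * (1 + |s|) ^ 4) := by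
      refine hai.trans ?_
      gcongr
    have s1 : 1 + |s| ≤ Real.exp (1 + |s|) := by linarith [Real.add_one_le_exp (1 + |s|)]
    have s2 : (1 + |s|) ^ 4 ≤ 24 * Real.exp (1 + |s|) := by
      have := Real.pow_div_factorial_le_exp (1 + |s|) (by positivity) 4
      norm_num [Nat.factorial] at this
      linarith
    have s3 : 1 ≤ Real.exp (l / 2) := Real.one_le_exp (by positivity)
    have s4 : 1 ≤ Real.exp (1 + |s|) := Real.one_le_exp (by positivity)
    have hE : 0 < Real.exp M := Real.exp_pos _
    calc _ ≤ d * (K * Real.exp (l / 2)) * Real.exp M + d * (1 + |s|) * Real.exp M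
          + Real.exp M * (d * (1 + |s|) ^ 4) :=
          (norm_add_le _ _).trans (add_le_add ((norm_add_le _ _).trans (add_le_add t1 t2)) t3)
      _ = d * Real.exp M * (K * Real.exp (l / 2) * 1 + 1 * (1 + |s|) + 1 * (1 + |s|) ^ 4) := by ring
      _ ≤ d * Real.exp M * (K * Real.exp (l / 2) * Real.exp (1 + |s|) +
            Real.exp (l / 2) * Real.exp (1 + |s|) + Real.exp (l / 2) * (24 * Real.exp (1 + |s|))) := by
          gcongr
      _ = _ := by ring
  have e2 : Complex.exp ((z + l) ^ 2 * d / 4) * (fp d N p η * Complex.exp (-η * (z + l))) -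
      Complex.exp (η ^ 3 / 3) * Complex.exp (-η * (z + l)) =
      (Complex.exp ((z + l) ^ 2 * d / 4) * fp d N p η - Complex.exp (η ^ 3 / 3)) *
        Complex.exp (-η * (z + l)) := by ring
  rw [e2, norm_mul]
  have habs := absorb s (R + 1)
  calc _ ≤ (d * Real.exp M * Real.exp (l / 2) * ((K + 1 + 24) * Real.exp (1 + |s|))) *
        Real.exp (1 * R - 1 * l + |s| * R) := by gcongr
    _ = (K + 1 + 24) * d * (Real.exp M * Real.exp (l / 2) * Real.exp (1 + |s|) *
        Real.exp (1 * R - 1 * l + |s| * R)) := by ring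
    _ ≤ (K + 1 + 24) * d * (Real.exp (4 / 3 + 1 + R + 2 * (R + 1) ^ 2) * Real.exp (-l / 2) *
        Real.exp (-(1 / 8) * s ^ 2)) := by
        refine mul_le_mul_of_nonneg_left ?_ (by positivity)
        rw [← Real.exp_add, ← Real.exp_add, ← Real.exp_add, ← Real.exp_add, ← Real.exp_add,
          Real.exp_le_exp]
        rw [hM]
        linarith
    _ = _ := by rw [C1]; ring

lemma near_bound (d : ℝ) (hd : 0 < d) (hd1 : d ≤ 1) (N p : ℕ) (hN : N * d ^ 3 = 1)
    (hp : p = N ∨ p + 1 = N) (R l : ℝ) (z : ℂ) (hz : ‖z‖ ≤ R) (hl : 0 ≤ l) (hld : l * d ≤ 1) :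
    ‖JJ d N p 1 (z + l) - AiryC (z + l)‖ ≤ C1 R * G0 * (d * Real.exp (-l / 2)) := by
  have i1 := (((GB_fp d hd hd1 N p hN hp).mul_exp 1 1 (z + l)).integrable).const_mul
    (Complex.exp ((z + l) ^ 2 * d / 4))
  have i2 := (GB_airy.mul_exp 1 1 (z + l)).integrable
  simp only [Complex.ofReal_one, one_mul] at i1 i2
  have e : JJ d N p 1 (z + l) - AiryC (z + l) = 1 / (2 * (Real.pi : ℂ)) * ∫ s : ℝ,
      (Complex.exp ((z + l) ^ 2 * d / 4) * (fp d N p (((1:ℝ):ℂ) + s * Complex.I) *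
        Complex.exp (-(((1:ℝ):ℂ) + s * Complex.I) * (z + l))) -
      Complex.exp ((((1:ℝ):ℂ) + s * Complex.I) ^ 3 / 3) *
        Complex.exp (-(((1:ℝ):ℂ) + s * Complex.I) * (z + l))) := by
    rw [integral_sub (by simpa using i1) (by simpa using i2), integral_const_mul, AiryC_eq, JJ]
    ring
  rw [e]
  refine (int_bound (fun s => near_pointwise d hd hd1 N p hN hp s R l z hz hl hld)).trans
    (le_of_eq (by ring))

/-- Normalising constant. -/
noncomputable def Kc (q : ℝ) (p : ℕ) : ℝ :=
  (q / Real.sqrt 2 / Real.sqrt Real.pi) * 2 ^ p * (q ^ 3 / Real.sqrt 2) ^ p *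
    Real.exp (-q ^ 6 / 2) * (2 * Real.pi)

lemma Kc_pos (q : ℝ) (hq : 0 < q) (p : ℕ) : 0 < Kc q p := by
  have := Real.pi_pos
  unfold Kc; positivity

lemma VV_eq_JJ (q : ℝ) (hq : 0 < q) (d : ℝ) (hd : d * q ^ 2 = 1) (N p : ℕ) (hN : (N:ℝ) = q ^ 6) (A : ℝ) (T : ℂ) :
    VV (Real.sqrt 2 * q ^ 3) (1 / (Real.sqrt 2 * q)) p T = Kc q p * JJ d N p A T := by
  have h2 : (0:ℝ) < Real.sqrt 2 := by positivity
  have hb : 0 < q / Real.sqrt 2 := by positivity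
  rw [VV, UU, hermiteHC_eq (q / Real.sqrt 2 * (q ^ 2 + A)) (q / Real.sqrt 2) hb, JJ, Gk, Kc]
  have hs2 : ((Real.sqrt 2 : ℝ) : ℂ) ^ 2 = 2 := by
    rw [← Complex.ofReal_pow, Real.sq_sqrt (by norm_num)]; simp
  have hs0 : ((Real.sqrt 2 : ℝ) : ℂ) ≠ 0 := by exact_mod_cast h2.ne'
  have hq0 : (q : ℂ) ≠ 0 := by exact_mod_cast hq.ne'
  have hp0 : (Real.pi : ℂ) ≠ 0 := by exact_mod_cast Real.pi_pos.ne'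
  have hdq : (d : ℂ) * q ^ 2 = 1 := by exact_mod_cast hd
  have hd' : (d : ℂ) = 1 / q ^ 2 := by field_simp; exact hdq
  have hNc : (N : ℂ) = q ^ 6 := by exact_mod_cast congrArg (fun x : ℝ => (x : ℂ)) hN
  have key : ∀ s : ℝ, Complex.exp (-(((Real.sqrt 2 * q ^ 3 : ℝ) : ℂ) + ((1 / (Real.sqrt 2 * q) : ℝ) : ℂ) * T) ^ 2 / 2) *
      (Complex.exp ((((Real.sqrt 2 * q ^ 3 : ℝ) : ℂ) + ((1 / (Real.sqrt 2 * q) : ℝ) : ℂ) * T) ^ 2) *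
      (((((q / Real.sqrt 2 * (q ^ 2 + A) : ℝ) : ℂ) + ((q / Real.sqrt 2 : ℝ) : ℂ) * s * Complex.I) ^ p *
      Complex.exp ((((q / Real.sqrt 2 * (q ^ 2 + A) : ℝ) : ℂ) + ((q / Real.sqrt 2 : ℝ) : ℂ) * s * Complex.I) ^ 2)) *
      Complex.exp (-(((q / Real.sqrt 2 * (q ^ 2 + A) : ℝ) : ℂ) + ((q / Real.sqrt 2 : ℝ) : ℂ) * s * Complex.I) *
        (2 * (((Real.sqrt 2 * q ^ 3 : ℝ) : ℂ) + ((1 / (Real.sqrt 2 * q) : ℝ) : ℂ) * T))))) =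
      ((q ^ 3 / Real.sqrt 2 : ℝ) : ℂ) ^ p * ((Real.exp (-q ^ 6 / 2) : ℝ) : ℂ) * (Complex.exp (T ^ 2 * d / 4) *
        (fp d N p ((A:ℂ) + s * Complex.I) * Complex.exp (-((A:ℂ) + s * Complex.I) * T))) := by
    intro s
    have ew : ((q / Real.sqrt 2 * (q ^ 2 + A) : ℝ) : ℂ) + ((q / Real.sqrt 2 : ℝ) : ℂ) * s * Complex.I =
        ((q ^ 3 / Real.sqrt 2 : ℝ) : ℂ) * (1 + d * ((A:ℂ) + s * Complex.I)) := by
      push_cast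
      field_simp
      linear_combination (-(A : ℂ) - s * Complex.I) * hdq
    rw [ew, fp]
    set η := (A:ℂ) + s * Complex.I with hη
    rw [mul_pow]
    have e : ∀ x1 x2 x3 x4 P1 P2 : ℂ, Complex.exp x1 * (Complex.exp x2 * ((P1 * P2) * Complex.exp x3 * Complex.exp x4))
      = P1 * P2 * Complex.exp (x1 + x2 + x3 + x4) := by
      intro x1 x2 x3 x4 P1 P2
      simp only [Complex.exp_add]; ring
    have e' : ∀ x1 x2 x3 x4 P1 P2 : ℂ, P1 * Complex.exp x1 * (Complex.exp x2 * ((P2 * Complex.exp x3) * Complex.exp x4))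
      = P1 * P2 * Complex.exp (x1 + x2 + x3 + x4) := by
      intro x1 x2 x3 x4 P1 P2
      simp only [Complex.exp_add]; ring
    rw [e, Complex.ofReal_exp, e']
    congr 2
    rw [hNc, hd']
    push_cast
    have hs4 : ((Real.sqrt 2 : ℝ) : ℂ) ^ 4 = 4 := by
      linear_combination (((Real.sqrt 2 : ℝ) : ℂ) ^ 2 + 2) * hs2
    field_simp
    ring_nf
    simp only [hs2, hs4]
    ring
  have key2 := congrArg (fun g : ℝ → ℂ => ∫ s, g s) (funext key)
  simp only [integral_const_mul] at key2
  push_cast at key2 ⊢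
  have hpi : (2 * (Real.pi : ℂ)) * (1 / (2 * (Real.pi:ℂ))) = 1 := by field_simp
  linear_combination (((q:ℂ) / (Real.sqrt 2:ℝ) / (Real.sqrt Real.pi : ℝ)) * 2 ^ p) * key2 -
    (((q:ℂ) / (Real.sqrt 2:ℝ) / (Real.sqrt Real.pi : ℝ)) * 2 ^ p) * ((q:ℂ) ^ 3 / (Real.sqrt 2:ℝ)) ^ p *
      Complex.exp (-q ^ 6 / 2) * (Complex.exp (T ^ 2 * d / 4) *
      ∫ s : ℝ, fp d N p ((A:ℂ) + s * Complex.I) * Complex.exp (-((A:ℂ) + s * Complex.I) * T)) * hpi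

lemma JJ_indep (q : ℝ) (hq : 0 < q) (d : ℝ) (hd : d * q ^ 2 = 1) (N p : ℕ) (hN : (N:ℝ) = q ^ 6) (A : ℝ) (T : ℂ) :
    JJ d N p 1 T = JJ d N p A T := by
  have h1 := VV_eq_JJ q hq d hd N p hN 1 T
  have h2 := VV_eq_JJ q hq d hd N p hN A T
  have h3 : (Kc q p : ℂ) ≠ 0 := by exact_mod_cast (Kc_pos q hq p).ne'
  exact mul_left_cancel₀ h3 (h1.symm.trans h2)

lemma Dec_JJ (q : ℝ) (hq : 0 < q) (d : ℝ) (hd : d * q ^ 2 = 1) (N p : ℕ) (hN : (N:ℝ) = q ^ 6) (r : ℝ) :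
    Dec r (JJ d N p 1) := by
  have h := (Dec_VV (Real.sqrt 2 * q ^ 3) (1 / (Real.sqrt 2 * q)) (by positivity) p r).const_mul
    ((Kc q p : ℂ)⁻¹)
  have h3 : (Kc q p : ℂ) ≠ 0 := by exact_mod_cast (Kc_pos q hq p).ne'
  have e : JJ d N p 1 = fun z => (Kc q p : ℂ)⁻¹ * VV (Real.sqrt 2 * q ^ 3) (1 / (Real.sqrt 2 * q)) p z := by
    funext z
    rw [VV_eq_JJ q hq d hd N p hN 1 z, inv_mul_cancel_left₀ h3]
  rw [e]; exact h

lemma far_pointwise (d : ℝ) (hd : 0 < d) (hd1 : d ≤ 1) (N p : ℕ) (hN : N * d ^ 3 = 1)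
    (hp : p = N ∨ p + 1 = N) (s R l : ℝ) (z : ℂ) (hz : ‖z‖ ≤ R) (hld : 1 ≤ l * d) :
    ‖Complex.exp ((z + l) ^ 2 * d / 4) * (fp d N p (((l * d / 2 : ℝ):ℂ) + s * Complex.I) *
        Complex.exp (-(((l * d / 2 : ℝ):ℂ) + s * Complex.I) * (z + l)))‖ ≤
    Real.exp (8 * R ^ 2) * Real.exp (-(1 / 16) * l) * Real.exp (-(1 / 8) * s ^ 2) := by
  have hR : 0 ≤ R := (norm_nonneg z).trans hz
  have hl : 0 < l := by
    by_contra h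
    nlinarith
  have hA : 0 < l * d / 2 := by positivity
  have hexp := norm_exp_eta (l * d / 2) s R l hA z hz
  have hle := (fp_le d hd N p hp (l * d / 2) s hA).trans (fp_norm d hd N (l * d / 2) s hA)
  have hT : ‖z + l‖ ≤ R + l := by
    refine (norm_add_le _ _).trans ?_
    have e : ‖(l : ℂ)‖ = l := by simp [abs_of_nonneg hl.le]
    linarith
  have hq : ‖Complex.exp ((z + l) ^ 2 * d / 4)‖ ≤ Real.exp (d * (R + l) ^ 2 / 4) := by
    rw [Complex.norm_exp, Real.exp_le_exp]
    refine (Complex.re_le_norm _).trans ?_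
    rw [norm_div, norm_mul, norm_pow]
    simp only [Complex.norm_real, Real.norm_eq_abs, abs_of_pos hd, Complex.norm_ofNat]
    calc ‖z + l‖ ^ 2 * d / 4 ≤ (R + l) ^ 2 * d / 4 := by gcongr
        _ = _ := by ring
  set a := d * (l * d / 2) with ha
  have had : d / 2 ≤ a := by rw [ha]; nlinarith
  have ha0 : 0 < a := by linarith
  have hlog : Real.log (1 + a) - a ≤ 0 := by
    have := Real.log_le_sub_one_of_pos (by linarith : 0 < 1 + a)
    linarith
  have hN0 : (0:ℝ) ≤ N := by positivity
  have hNa : (N:ℝ) * (Real.log (1 + a) - a + a ^ 2 / 2) ≤ l ^ 2 * d / 8 := by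
    have e : (N:ℝ) * (a ^ 2 / 2) = l ^ 2 * d / 8 := by
      rw [ha]; linear_combination l ^ 2 * d / 8 * hN
    have e2 := mul_nonpos_of_nonneg_of_nonpos hN0 hlog
    rw [mul_add]
    linarith
  have hfrac : 4 * d / 9 ≤ 1 - 1 / (1 + a) ^ 2 := by
    have h1 : 1 / (1 + a) ^ 2 ≤ 1 / (1 + d / 2) ^ 2 := by gcongr
    have h2 : 1 / (1 + d / 2) ^ 2 ≤ 1 - 4 * d / 9 := by
      rw [div_le_iff₀ (by positivity)]
      nlinarith [mul_pos hd hd, mul_nonneg hd.le (sub_nonneg.mpr hd1), mul_nonneg (mul_pos hd hd).le (sub_nonneg.mpr hd1)]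
    linarith
  have hNs : 2 / 9 * s ^ 2 ≤ N * d ^ 2 * s ^ 2 / 2 * (1 - 1 / (1 + a) ^ 2) := by
    calc 2 / 9 * s ^ 2 = N * d ^ 2 * s ^ 2 / 2 * (4 * d / 9) := by linear_combination -(2 / 9) * s ^ 2 * hN
      _ ≤ _ := by gcongr
  rw [norm_mul, norm_mul]
  calc _ ≤ Real.exp (d * (R + l) ^ 2 / 4) * (Real.exp (N * (Real.log (1 + a) - a + a ^ 2 / 2)
      - N * d ^ 2 * s ^ 2 / 2 * (1 - 1 / (1 + a) ^ 2)) *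
        Real.exp (l * d / 2 * R - l * d / 2 * l + |s| * R)) := by gcongr
    _ ≤ _ := by
      rw [← Real.exp_add, ← Real.exp_add, ← Real.exp_add, ← Real.exp_add, Real.exp_le_exp]
      have h1 : |s| * R ≤ 7 / 72 * s ^ 2 + 3 * R ^ 2 := by
        rw [← sq_abs s]; nlinarith [sq_nonneg (7 * |s| - 36 * R)]
      have h2 : R * l * d ≤ l ^ 2 * d / 16 + 4 * R ^ 2 * d := by
        nlinarith [mul_nonneg hd.le (sq_nonneg (l - 8 * R))]
      have h3 : l ≤ l ^ 2 * d := by nlinarith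
      have h4 : R ^ 2 * d ≤ R ^ 2 := mul_le_of_le_one_right (sq_nonneg R) hd1
      have h5 : d * (R + l) ^ 2 / 4 = R ^ 2 * d / 4 + R * l * d / 2 + l ^ 2 * d / 4 := by ring
      have h6 : l * d / 2 * R - l * d / 2 * l = R * l * d / 2 - l ^ 2 * d / 2 := by ring
      rw [h5, h6]
      linarith [sq_nonneg R]

lemma far_bound (q : ℝ) (hq : 0 < q) (d : ℝ) (hd : 0 < d) (hd1 : d ≤ 1) (hdq : d * q ^ 2 = 1) (N p : ℕ)
    (hNq : (N:ℝ) = q ^ 6) (hN : N * d ^ 3 = 1)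
    (hp : p = N ∨ p + 1 = N) (R l : ℝ) (z : ℂ) (hz : ‖z‖ ≤ R) (hld : 1 ≤ l * d) :
    ‖JJ d N p 1 (z + l)‖ ≤ Real.exp (8 * R ^ 2) * G0 * Real.exp (-(1 / 16) * l) := by
  rw [JJ_indep q hq d hdq N p hNq (l * d / 2)]
  have e : JJ d N p (l * d / 2) (z + l) = 1 / (2 * (Real.pi : ℂ)) * ∫ s : ℝ,
      (Complex.exp ((z + l) ^ 2 * d / 4) * (fp d N p (((l * d / 2 : ℝ):ℂ) + s * Complex.I) *
        Complex.exp (-(((l * d / 2 : ℝ):ℂ) + s * Complex.I) * (z + l)))) := by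
    rw [integral_const_mul, JJ]; ring
  rw [e]
  refine (int_bound (fun s => far_pointwise d hd hd1 N p hN hp s R l z hz hld)).trans
    (le_of_eq (by ring))

/-- Overall constant. -/
noncomputable def C2 (R : ℝ) : ℝ :=
  C1 R * G0 + 32 * (Real.exp (8 * R ^ 2) * G0 + Real.exp (1 / 3 + R + 2 * R ^ 2) * G0)

lemma C2_nonneg (R : ℝ) : 0 ≤ C2 R := by
  have := G0_nonneg
  unfold C2 C1; positivity

lemma JJ_sub_bound (q : ℝ) (hq : 0 < q) (d : ℝ) (hd : 0 < d) (hd1 : d ≤ 1) (hdq : d * q ^ 2 = 1) (N p : ℕ)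
    (hNq : (N:ℝ) = q ^ 6) (hN : N * d ^ 3 = 1)
    (hp : p = N ∨ p + 1 = N) (R l : ℝ) (z : ℂ) (hz : ‖z‖ ≤ R) (hl : 0 ≤ l) :
    ‖JJ d N p 1 (z + l) - AiryC (z + l)‖ ≤ C2 R * d * Real.exp (-(1 / 32) * l) := by
  have hG := G0_nonneg
  have hC1 : 0 ≤ C1 R := by unfold C1; positivity
  rcases le_total (l * d) 1 with h | h
  · refine (near_bound d hd hd1 N p hN hp R l z hz hl h).trans ?_
    have h1 : C1 R * G0 ≤ C2 R := by
      unfold C2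
      have : 0 ≤ 32 * (Real.exp (8 * R ^ 2) * G0 + Real.exp (1 / 3 + R + 2 * R ^ 2) * G0) := by positivity
      linarith
    have h2 : Real.exp (-l / 2) ≤ Real.exp (-(1 / 32) * l) := by
      rw [Real.exp_le_exp]; linarith
    calc _ ≤ C2 R * (d * Real.exp (-(1 / 32) * l)) := by gcongr; exact C2_nonneg R
      _ = _ := by ring
  · have h1 := far_bound q hq d hd hd1 hdq N p hNq hN hp R l z hz h
    have h2 := AiryC_bound R l z hz
    have h3 : Real.exp (-(1 / 32) * l) ≤ 32 * d := by
      have hx := Real.add_one_le_exp ((1 / 32) * l)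
      have hm : Real.exp (-(1 / 32) * l) * Real.exp ((1 / 32) * l) = 1 := by
        rw [← Real.exp_add]; simp
      have hpos := Real.exp_pos (-(1 / 32) * l)
      have : Real.exp (-(1 / 32) * l) * l ≤ 32 := by nlinarith
      calc Real.exp (-(1 / 32) * l) ≤ Real.exp (-(1 / 32) * l) * (l * d) := le_mul_of_one_le_right hpos.le h
        _ = (Real.exp (-(1 / 32) * l) * l) * d := by ring
        _ ≤ _ := by gcongr
    have h4 : Real.exp (-(1 / 16) * l) ≤ 32 * d * Real.exp (-(1 / 32) * l) := by
      calc Real.exp (-(1 / 16) * l) = Real.exp (-(1 / 32) * l) * Real.exp (-(1 / 32) * l) := by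
            rw [← Real.exp_add]; congr 1; ring
        _ ≤ _ := by gcongr
    have h5 : Real.exp (-l) ≤ Real.exp (-(1 / 16) * l) := by
      rw [Real.exp_le_exp]; linarith
    calc _ ≤ Real.exp (8 * R ^ 2) * G0 * Real.exp (-(1 / 16) * l) +
          Real.exp (1 / 3 + R + 2 * R ^ 2) * G0 * Real.exp (-l) := (norm_sub_le _ _).trans (add_le_add h1 h2)
      _ ≤ Real.exp (8 * R ^ 2) * G0 * (32 * d * Real.exp (-(1 / 32) * l)) +
          Real.exp (1 / 3 + R + 2 * R ^ 2) * G0 * (32 * d * Real.exp (-(1 / 32) * l)) := by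
          gcongr; exact h5.trans h4
      _ ≤ _ := by
          unfold C2
          have : 0 ≤ C1 R * G0 * d * Real.exp (-(1 / 32) * l) := by positivity
          nlinarith

lemma JJ_deriv_sub_bound (q : ℝ) (hq : 0 < q) (d : ℝ) (hd : 0 < d) (hd1 : d ≤ 1) (hdq : d * q ^ 2 = 1) (N p : ℕ)
    (hNq : (N:ℝ) = q ^ 6) (hN : N * d ^ 3 = 1)
    (hp : p = N ∨ p + 1 = N) (n : ℕ) (R l : ℝ) (z : ℂ) (hz : ‖z‖ ≤ R) (hl : 0 ≤ l) :
    ‖iteratedDeriv n (JJ d N p 1) (z + l) - iteratedDeriv n AiryC (z + l)‖ ≤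
      C2 (R + n) * d * Real.exp (-(1 / 32) * l) := by
  have hJ := (Dec_JJ q hq d hdq N p hNq 1).1
  have h := iteratedDeriv_decay (f := fun z => JJ d N p 1 z - AiryC z) (hJ.sub AiryC_differentiable) n
    (r := 1 / 32) (R := R) (C := C2 (R + n) * d)
    (fun z hz l hl => JJ_sub_bound q hq d hd hd1 hdq N p hNq hN hp (R + n) l z hz hl) z hz l hl
  rwa [iteratedDeriv_fun_sub hJ.contDiff.contDiffAt AiryC_differentiable.contDiff.contDiffAt] at h

/-- Stirling ratio. -/
noncomputable def QQ (N : ℕ) : ℝ := Real.sqrt Real.pi / Stirling.stirlingSeq N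

lemma stirling_upper (n : ℕ) :
    Real.log (Stirling.stirlingSeq (n + 1)) - 1 / (12 * ((n:ℝ) + 1)) ≤ Real.log (Real.sqrt Real.pi) := by
  have hmono : Monotone (fun n : ℕ => Real.log (Stirling.stirlingSeq (n + 1)) - 1 / (12 * ((n:ℝ) + 1))) := by
    refine monotone_nat_of_le_succ fun n => ?_
    have h := Stirling.log_stirlingSeq_sdiff_le (n + 1)
    have e : 1 / (12 * ((n + 1 : ℕ) : ℝ) * (((n + 1 : ℕ) : ℝ) + 1)) =
        1 / (12 * ((n:ℝ) + 1)) - 1 / (12 * (((n + 1 : ℕ) : ℝ) + 1)) := by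
      push_cast
      have : (n:ℝ) + 1 ≠ 0 := by positivity
      have : (n:ℝ) + 1 + 1 ≠ 0 := by positivity
      field_simp
      ring
    rw [e] at h
    linarith
  have hlim : Tendsto (fun n : ℕ => Real.log (Stirling.stirlingSeq (n + 1)) - 1 / (12 * ((n:ℝ) + 1))) atTop
      (nhds (Real.log (Real.sqrt Real.pi) - 0)) := by
    refine Tendsto.sub ?_ ?_
    · have hpi : Real.sqrt Real.pi ≠ 0 := (Real.sqrt_pos.mpr Real.pi_pos).ne'
      exact (Stirling.tendsto_stirlingSeq_sqrt_pi.comp (tendsto_add_atTop_nat 1)).log hpi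
    · have h := (tendsto_one_div_add_atTop_nhds_zero_nat (𝕜 := ℝ)).const_mul (1 / 12)
      rw [mul_zero] at h
      refine h.congr fun n => ?_
      have : (n:ℝ) + 1 ≠ 0 := by positivity
      field_simp
  rw [sub_zero] at hlim
  exact hmono.ge_of_tendsto hlim n

lemma QQ_bound (n : ℕ) : 0 ≤ QQ (n + 1) ∧ QQ (n + 1) ≤ 1 ∧ 1 - QQ (n + 1) ≤ 1 / ((n:ℝ) + 1) := by
  have hS := Stirling.stirlingSeq'_pos n
  have hpi : 0 < Real.sqrt Real.pi := Real.sqrt_pos.mpr Real.pi_pos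
  have hle := Stirling.sqrt_pi_le_stirlingSeq (Nat.succ_ne_zero n)
  have hQ : 0 < QQ (n + 1) := div_pos hpi hS
  refine ⟨hQ.le, (div_le_one hS).mpr hle, ?_⟩
  have h := stirling_upper n
  have hlog : Real.log (QQ (n + 1)) = Real.log (Real.sqrt Real.pi) - Real.log (Stirling.stirlingSeq (n + 1)) :=
    Real.log_div hpi.ne' hS.ne'
  have h2 := Real.log_le_sub_one_of_pos hQ
  have h3 : 1 / (12 * ((n:ℝ) + 1)) ≤ 1 / ((n:ℝ) + 1) := by
    apply one_div_le_one_div_of_le <;> [positivity; skip]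
    have : (0:ℝ) ≤ n := by positivity
    linarith
  have h4 := Real.add_one_le_exp (Real.log (QQ (n + 1)))
  rw [Real.exp_log hQ] at h4
  linarith

/-- A constant. -/
noncomputable def I0 : ℝ := ∫ l in Set.Ioi (0:ℝ), Real.exp (-(1 / 32) * l)

lemma I0_nonneg : 0 ≤ I0 := integral_nonneg fun _ => (Real.exp_pos _).le

lemma BB_norm_le {f g : ℂ → ℂ} {u v : ℂ} {C : ℝ}
    (h : ∀ l : ℝ, 0 ≤ l → ‖f (u + l) * g (v + l)‖ ≤ C * Real.exp (-(1 / 32) * l)) :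
    ‖BB f g u v‖ ≤ C * I0 := by
  rw [BB, I0, ← integral_const_mul]
  refine norm_integral_le_of_norm_le (integrable_exp_neg_Ioi (by norm_num) C) ?_
  exact (ae_restrict_mem measurableSet_Ioi).mono fun l hl => h l (le_of_lt hl)

lemma BB_sub_le {f g F G : ℂ → ℂ} (hf : Dec (1 / 32) f) (hg : Dec (1 / 32) g)
    (hF : Dec (1 / 32) F) (hG : Dec (1 / 32) G) {u v : ℂ} {E B : ℝ} (hE : 0 ≤ E) (hB : 0 ≤ B)
    (h1 : ∀ l : ℝ, 0 ≤ l → ‖f (u + l) - F (u + l)‖ ≤ E * Real.exp (-(1 / 32) * l))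
    (h2 : ∀ l : ℝ, 0 ≤ l → ‖g (v + l) - G (v + l)‖ ≤ E * Real.exp (-(1 / 32) * l))
    (h3 : ∀ l : ℝ, 0 ≤ l → ‖F (u + l)‖ ≤ B * Real.exp (-(1 / 32) * l))
    (h4 : ∀ l : ℝ, 0 ≤ l → ‖G (v + l)‖ ≤ B * Real.exp (-(1 / 32) * l)) :
    ‖BB f g u v - BB F G u v‖ ≤ E * (2 * B + E) * I0 := by
  rw [BB, BB, ← integral_sub (hf.integrable (by norm_num) hg u v) (hF.integrable (by norm_num) hG u v),
    I0, ← integral_const_mul]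
  refine norm_integral_le_of_norm_le (integrable_exp_neg_Ioi (by norm_num) _) ?_
  refine (ae_restrict_mem measurableSet_Ioi).mono fun l hl => ?_
  have hl : 0 ≤ l := le_of_lt hl
  have e1 : Real.exp (-(1 / 32) * l) ≤ 1 := Real.exp_le_one_iff.mpr (by linarith)
  have e0 : 0 < Real.exp (-(1 / 32) * l) := Real.exp_pos _
  specialize h1 l hl
  specialize h2 l hl
  specialize h3 l hl
  specialize h4 l hl
  set x := Real.exp (-(1 / 32) * l)
  have h5 : ‖g (v + l)‖ ≤ B + E := by
    calc ‖g (v + l)‖ = ‖G (v + l) + (g (v + l) - G (v + l))‖ := by congr 1; ring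
      _ ≤ B * x + E * x := (norm_add_le _ _).trans (add_le_add h4 h2)
      _ ≤ B * 1 + E * 1 := by gcongr
      _ = _ := by ring
  have h6 : ‖F (u + l)‖ ≤ B := h3.trans (by nlinarith)
  calc _ = ‖(f (u + l) - F (u + l)) * g (v + l) + F (u + l) * (g (v + l) - G (v + l))‖ := by
        congr 1; ring
    _ ≤ (E * x) * (B + E) + B * (E * x) := by
        refine (norm_add_le _ _).trans ?_
        rw [norm_mul, norm_mul]
        gcongr
    _ = _ := by ring

lemma TT_bound {f₁ g₁ f₂ g₂ F G : ℂ → ℂ} {c t s : ℂ} {Q δ b : ℝ} (hQ0 : 0 ≤ Q) (hQ1 : Q ≤ 1)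
    (hQd : 1 - Q ≤ b)
    {B : ℝ} (h1 : ‖BB f₁ g₁ (c * t) (c * s) - BB F G (c * t) (c * s)‖ ≤ δ)
    (h2 : ‖BB f₂ g₂ (c * t) (c * s) - BB F G (c * t) (c * s)‖ ≤ δ)
    (h3 : ‖BB F G (c * t) (c * s)‖ ≤ B) :
    ‖TT c ((Q / 2 : ℝ) : ℂ) f₁ g₁ f₂ g₂ F G t s‖ ≤ ‖c‖ * (δ + b * B) := by
  have hδ : 0 ≤ δ := (norm_nonneg _).trans h1
  have hB : 0 ≤ B := (norm_nonneg _).trans h3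
  have e : TT c ((Q / 2 : ℝ) : ℂ) f₁ g₁ f₂ g₂ F G t s = c * (((Q / 2 : ℝ) : ℂ) *
      ((BB f₁ g₁ (c * t) (c * s) - BB F G (c * t) (c * s)) +
       (BB f₂ g₂ (c * t) (c * s) - BB F G (c * t) (c * s))) - ((1 - Q : ℝ) : ℂ) * BB F G (c * t) (c * s)) := by
    rw [TT]; push_cast; ring
  rw [e, norm_mul]
  gcongr
  refine (norm_sub_le _ _).trans ?_
  rw [norm_mul, norm_mul, Complex.norm_real, Complex.norm_real, Real.norm_eq_abs, Real.norm_eq_abs,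
    abs_of_nonneg (by linarith), abs_of_nonneg (by linarith)]
  have h5 := (norm_add_le (BB f₁ g₁ (c * t) (c * s) - BB F G (c * t) (c * s))
    (BB f₂ g₂ (c * t) (c * s) - BB F G (c * t) (c * s))).trans (add_le_add h1 h2)
  have h6 : Q / 2 * ‖(BB f₁ g₁ (c * t) (c * s) - BB F G (c * t) (c * s)) +
    (BB f₂ g₂ (c * t) (c * s) - BB F G (c * t) (c * s))‖ ≤ 1 / 2 * (δ + δ) := by gcongr
  have h7 : (1 - Q) * ‖BB F G (c * t) (c * s)‖ ≤ b * B := by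
    apply mul_le_mul hQd h3 (norm_nonneg _) (by linarith)
  linarith

lemma coef_eq (q : ℝ) (hq : 0 < q) (n : ℕ) (hN : ((n + 1 : ℕ) : ℝ) = q ^ 6) :
    ww n * Kc q (n + 1) * Kc q n = 2 * q ^ 2 * QQ (n + 1) := by
  have hpi := Real.pi_pos
  have hs : Real.sqrt 2 ^ 2 = 2 := Real.sq_sqrt (by norm_num)
  have hsp : Real.sqrt Real.pi ^ 2 = Real.pi := Real.sq_sqrt hpi.le
  have h20 : (0:ℝ) < Real.sqrt 2 := by positivity
  have hp0 : (0:ℝ) < Real.sqrt Real.pi := Real.sqrt_pos.mpr hpi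
  have hsq : Real.sqrt (2 * ((n + 1 : ℕ) : ℝ)) = Real.sqrt 2 * q ^ 3 := by
    rw [Real.sqrt_mul (by norm_num), hN, show q ^ 6 = (q ^ 3) ^ 2 by ring, Real.sqrt_sq (by positivity)]
  have hfac : ((n + 1).factorial : ℝ) = q ^ 6 * n.factorial := by
    rw [Nat.factorial_succ]; push_cast; push_cast at hN; rw [hN]
  rw [QQ, Stirling.stirlingSeq, hsq, hfac, hN, ww, Kc, Kc]
  have hexp : Real.exp 1 ^ (n + 1) = Real.exp (q ^ 6) := by
    rw [← Real.exp_nat_mul, mul_one, hN]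
  have he2 : Real.exp (-q ^ 6 / 2) * Real.exp (-q ^ 6 / 2) = (Real.exp (q ^ 6))⁻¹ := by
    rw [← Real.exp_add, ← Real.exp_neg]; congr 1; ring
  rw [div_pow (q ^ 6), hexp]
  have hnf : (n.factorial : ℝ) ≠ 0 := by positivity
  have hE : Real.exp (q ^ 6) ≠ 0 := (Real.exp_pos _).ne'
  have hpow : (q ^ 3 / Real.sqrt 2) ^ n * (q ^ 3 / Real.sqrt 2) ^ n * 2 ^ n = (q ^ 6) ^ n := by
    rw [← mul_pow, ← mul_pow]; congr 1
    field_simp; rw [hs]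
  rw [pow_succ (q ^ 3 / Real.sqrt 2), pow_succ (2:ℝ), pow_succ (q ^ 6)]
  calc _ = (Real.exp (-q ^ 6 / 2) * Real.exp (-q ^ 6 / 2)) *
        ((q ^ 3 / Real.sqrt 2) ^ n * (q ^ 3 / Real.sqrt 2) ^ n * 2 ^ n) *
        (q ^ 2 * (q ^ 3 / Real.sqrt 2) * 8 * Real.pi ^ 2 / (Real.sqrt 2 ^ 2) / (Real.sqrt Real.pi ^ 2) /
          Real.sqrt Real.pi / n.factorial) := by
        field_simp
        ring
    _ = _ := by
        rw [he2, hpow, hs, hsp]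
        field_simp
        rw [hs, hsp]
        ring

lemma psiHC_eq (ρ : ℝ) (hρ : 0 < ρ) (k : ℕ) (z : ℂ) :
    psiHC (ρ ^ 6) k z = ((Real.sqrt (Real.sqrt Real.pi * 2^k * (Nat.factorial k) * ρ ^ 3) : ℝ) : ℂ)⁻¹ *
      UU k (z / (ρ:ℂ) ^ 3) := by
  have hs : Real.sqrt (ρ ^ 6) = ρ ^ 3 := by
    rw [show ρ ^ 6 = (ρ ^ 3) ^ 2 by ring, Real.sqrt_sq (by positivity)]
  have h0 : (ρ : ℂ) ≠ 0 := by exact_mod_cast hρ.ne'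
  rw [psiHC, hs, UU, mul_assoc]
  congr 2
  · congr 1
    push_cast
    field_simp
  · push_cast; rfl

lemma ker_eq (m q : ℝ) (hm : 0 < m) (hq : 0 < q) (n : ℕ) (t s : ℂ) :
    (((m / q) ^ 4 : ℝ) : ℂ) * KerKC ((m / q) ^ 6) (n + 1)
      (((Real.sqrt 2 * m ^ 3 : ℝ) : ℂ) + (((m / q) ^ 4 : ℝ) : ℂ) * t)
      (((Real.sqrt 2 * m ^ 3 : ℝ) : ℂ) + (((m / q) ^ 4 : ℝ) : ℂ) * s) =
    ((m / q : ℝ) : ℂ) * ∑ k ∈ Finset.range (n + 1), (ww k : ℂ) *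
      (VV (Real.sqrt 2 * q ^ 3) (1 / (Real.sqrt 2 * q)) k (((Real.sqrt 2 * m : ℝ) : ℂ) * t) *
       VV (Real.sqrt 2 * q ^ 3) (1 / (Real.sqrt 2 * q)) k (((Real.sqrt 2 * m : ℝ) : ℂ) * s)) := by
  have hρ : 0 < m / q := by positivity
  rw [KerKC, Finset.mul_sum, Finset.mul_sum]
  refine Finset.sum_congr rfl fun k _ => ?_
  have h2 : (0:ℝ) < Real.sqrt 2 := by positivity
  have hs0 : ((Real.sqrt 2 : ℝ) : ℂ) ≠ 0 := by exact_mod_cast h2.ne'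
  have hq0 : (q : ℂ) ≠ 0 := by exact_mod_cast hq.ne'
  have hm0 : (m : ℂ) ≠ 0 := by exact_mod_cast hm.ne'
  have harg : ∀ t : ℂ, (((Real.sqrt 2 * m ^ 3 : ℝ) : ℂ) + (((m / q) ^ 4 : ℝ) : ℂ) * t) / ((m / q : ℝ) : ℂ) ^ 3 =
      ((Real.sqrt 2 * q ^ 3 : ℝ) : ℂ) + ((1 / (Real.sqrt 2 * q) : ℝ) : ℂ) * (((Real.sqrt 2 * m : ℝ) : ℂ) * t) := by
    intro t
    push_cast
    field_simp
  rw [psiHC_eq _ hρ, psiHC_eq _ hρ, harg, harg, VV, VV]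
  have hX : (0:ℝ) < Real.sqrt Real.pi * 2^k * (Nat.factorial k) := by
    have := Real.pi_pos
    positivity
  have hw : ((Real.sqrt (Real.sqrt Real.pi * 2^k * (Nat.factorial k) * (m / q) ^ 3) : ℝ) : ℂ)⁻¹ *
      ((Real.sqrt (Real.sqrt Real.pi * 2^k * (Nat.factorial k) * (m / q) ^ 3) : ℝ) : ℂ)⁻¹ *
      (((m / q) ^ 4 : ℝ) : ℂ) = ((m / q : ℝ) : ℂ) * (ww k : ℂ) := by
    rw [← Complex.ofReal_inv, ← Complex.ofReal_mul, ← Complex.ofReal_mul, ← Complex.ofReal_mul]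
    congr 1
    rw [← mul_inv, Real.mul_self_sqrt (by positivity), ww]
    field_simp
  linear_combination (UU k (((Real.sqrt 2 * q ^ 3 : ℝ) : ℂ) + ((1 / (Real.sqrt 2 * q) : ℝ) : ℂ) * (((Real.sqrt 2 * m : ℝ) : ℂ) * t)) *
    UU k (((Real.sqrt 2 * q ^ 3 : ℝ) : ℂ) + ((1 / (Real.sqrt 2 * q) : ℝ) : ℂ) * (((Real.sqrt 2 * m : ℝ) : ℂ) * s))) * hw

lemma BB_const_mul (a b : ℂ) (f g : ℂ → ℂ) (u v : ℂ) :
    BB (fun z => a * f z) (fun z => b * g z) u v = a * b * BB f g u v := by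
  rw [BB, BB, ← integral_const_mul]
  congr 1; funext l; ring

lemma ker_eq_TT (m q : ℝ) (hm : 0 < m) (hq : 0 < q) (d : ℝ) (hd : d * q ^ 2 = 1) (n : ℕ)
    (hN : ((n + 1 : ℕ) : ℝ) = q ^ 6) (t s : ℂ) :
    (((m / q) ^ 4 : ℝ) : ℂ) * KerKC ((m / q) ^ 6) (n + 1)
      (((Real.sqrt 2 * m ^ 3 : ℝ) : ℂ) + (((m / q) ^ 4 : ℝ) : ℂ) * t)
      (((Real.sqrt 2 * m ^ 3 : ℝ) : ℂ) + (((m / q) ^ 4 : ℝ) : ℂ) * s)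
      - ((Real.sqrt 2 * m : ℝ) : ℂ) *
        KAiryC (((Real.sqrt 2 * m : ℝ) : ℂ) * t) (((Real.sqrt 2 * m : ℝ) : ℂ) * s) =
    TT ((Real.sqrt 2 * m : ℝ) : ℂ) ((QQ (n + 1) / 2 : ℝ) : ℂ)
      (JJ d (n + 1) (n + 1) 1) (JJ d (n + 1) n 1) (JJ d (n + 1) n 1) (JJ d (n + 1) (n + 1) 1) AiryC AiryC t s := by
  rw [ker_eq m q hm hq, CD_integral _ _ (by positivity)]
  have e1 : ∀ p, VV (Real.sqrt 2 * q ^ 3) (1 / (Real.sqrt 2 * q)) p = fun z => (Kc q p : ℂ) * JJ d (n + 1) p 1 z :=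
    fun p => funext fun z => VV_eq_JJ q hq d hd (n + 1) p hN 1 z
  rw [e1, e1, BB_const_mul, BB_const_mul, TT]
  have hK : KAiryC (((Real.sqrt 2 * m : ℝ) : ℂ) * t) (((Real.sqrt 2 * m : ℝ) : ℂ) * s) =
    BB AiryC AiryC (((Real.sqrt 2 * m : ℝ) : ℂ) * t) (((Real.sqrt 2 * m : ℝ) : ℂ) * s) := rfl
  rw [hK]
  have hc := coef_eq q hq n hN
  have h2 : (0:ℝ) < Real.sqrt 2 := by positivity
  have hs : Real.sqrt 2 ^ 2 = 2 := Real.sq_sqrt (by norm_num)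
  have hcoef : (m / q) * (1 / (Real.sqrt 2 * q) * ww n / 2) * (Kc q (n + 1) * Kc q n) =
      Real.sqrt 2 * m * (QQ (n + 1) / 2) := by
    have : (m / q) * (1 / (Real.sqrt 2 * q) * ww n / 2) * (Kc q (n + 1) * Kc q n) =
      (m / q) * (1 / (Real.sqrt 2 * q) / 2) * (ww n * Kc q (n + 1) * Kc q n) := by ring
    rw [this, hc]
    field_simp
    rw [hs]
  have hcoef' := congrArg (fun x : ℝ => (x : ℂ)) hcoef
  push_cast at hcoef' ⊢
  linear_combination (BB (JJ d (n + 1) (n + 1) 1) (JJ d (n + 1) n 1) ((Real.sqrt 2 : ℝ) * m * t) ((Real.sqrt 2 : ℝ) * m * s) +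
    BB (JJ d (n + 1) n 1) (JJ d (n + 1) (n + 1) 1) ((Real.sqrt 2 : ℝ) * m * t) ((Real.sqrt 2 : ℝ) * m * s)) * hcoef'

lemma edge_main (m : ℝ) (hm : 0 < m) (R : ℝ) (α β : ℕ) :
    ∃ C > 0, ∀ (n : ℕ) (q d : ℝ), 0 < q → 0 < d → d ≤ 1 → d * q ^ 2 = 1 → ((n + 1 : ℕ) : ℝ) = q ^ 6 →
      ∀ t s : ℂ, ‖((Real.sqrt 2 * m : ℝ) : ℂ) * t‖ ≤ R → ‖((Real.sqrt 2 * m : ℝ) : ℂ) * s‖ ≤ R →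
      ‖iteratedDeriv α (fun t => iteratedDeriv β (fun s =>
        TT ((Real.sqrt 2 * m : ℝ) : ℂ) ((QQ (n + 1) / 2 : ℝ) : ℂ)
      (JJ d (n + 1) (n + 1) 1) (JJ d (n + 1) n 1) (JJ d (n + 1) n 1) (JJ d (n + 1) (n + 1) 1)
        AiryC AiryC t s) s) t‖ ≤ C * d := by
  obtain ⟨B1, hB1⟩ := (Dec_AiryC.iteratedDeriv α).2 R
  obtain ⟨B2, hB2⟩ := (Dec_AiryC.iteratedDeriv β).2 R
  obtain ⟨B3, hB3⟩ := (Dec_AiryC.iteratedDeriv α).mul_bound (by norm_num) (Dec_AiryC.iteratedDeriv β) R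
  set B := max (max B1 B2) 0 with hB
  have hB0 : 0 ≤ B := le_max_right _ _
  set E0 := C2 (R + α) + C2 (R + β) with hE0
  have hE00 : 0 ≤ E0 := add_nonneg (C2_nonneg _) (C2_nonneg _)
  set c := ((Real.sqrt 2 * m : ℝ) : ℂ) with hc
  have hI := I0_nonneg
  refine ⟨‖c‖ ^ β * (‖c‖ ^ α * (‖c‖ * (E0 * (2 * B + E0) * I0 + |B3| * I0))) + 1, by positivity, ?_⟩
  intro n q d hq hd hd1 hdq hN t s ht hs
  have hNd : ((n + 1 : ℕ) : ℝ) * d ^ 3 = 1 := by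
    rw [hN, show q ^ 6 * d ^ 3 = (d * q ^ 2) ^ 3 by ring, hdq, one_pow]
  have hJ1 := Dec_JJ q hq d hdq (n + 1) (n + 1) hN (1 / 32)
  have hJ2 := Dec_JJ q hq d hdq (n + 1) n hN (1 / 32)
  rw [TT_iteratedDeriv₂ (by norm_num) c _ hJ1 hJ2 Dec_AiryC hJ2 hJ1 Dec_AiryC α β t s]
  obtain ⟨hQ0, hQ1, hQd⟩ := QQ_bound n
  have hQd' : 1 - QQ (n + 1) ≤ d := by
    refine hQd.trans ?_
    have e : (n:ℝ) + 1 = q ^ 6 := by rw [← hN]; push_cast; ring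
    rw [e]
    have : 1 / q ^ 6 = d ^ 3 := by
      field_simp
      rw [show q ^ 6 * d ^ 3 = (d * q ^ 2) ^ 3 by ring, hdq, one_pow]
    rw [this]
    calc d ^ 3 ≤ d ^ 1 := pow_le_pow_of_le_one hd.le hd1 (by norm_num)
      _ = d := pow_one d
  have hsubα : ∀ p, (p = n + 1 ∨ p + 1 = n + 1) → ∀ l : ℝ, 0 ≤ l →
      ‖iteratedDeriv α (JJ d (n + 1) p 1) (c * t + l) - iteratedDeriv α AiryC (c * t + l)‖ ≤
        (E0 * d) * Real.exp (-(1 / 32) * l) := by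
    intro p hp l hl
    refine (JJ_deriv_sub_bound q hq d hd hd1 hdq (n + 1) p hN hNd hp α R l _ ht hl).trans ?_
    gcongr
    rw [hE0]; linarith [C2_nonneg (R + β)]
  have hsubβ : ∀ p, (p = n + 1 ∨ p + 1 = n + 1) → ∀ l : ℝ, 0 ≤ l →
      ‖iteratedDeriv β (JJ d (n + 1) p 1) (c * s + l) - iteratedDeriv β AiryC (c * s + l)‖ ≤
        (E0 * d) * Real.exp (-(1 / 32) * l) := by
    intro p hp l hl
    refine (JJ_deriv_sub_bound q hq d hd hd1 hdq (n + 1) p hN hNd hp β R l _ hs hl).trans ?_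
    gcongr
    rw [hE0]; linarith [C2_nonneg (R + α)]
  have hAα : ∀ l : ℝ, 0 ≤ l → ‖iteratedDeriv α AiryC (c * t + l)‖ ≤ B * Real.exp (-(1 / 32) * l) := by
    intro l hl
    refine (hB1 _ ht l hl).trans ?_
    gcongr
    exact (le_max_left _ _).trans (le_max_left _ _)
  have hAβ : ∀ l : ℝ, 0 ≤ l → ‖iteratedDeriv β AiryC (c * s + l)‖ ≤ B * Real.exp (-(1 / 32) * l) := by
    intro l hl
    refine (hB2 _ hs l hl).trans ?_
    gcongr
    exact (le_max_right _ _).trans (le_max_left _ _)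
  have hδ : (E0 * d) * (2 * B + E0 * d) * I0 ≤ E0 * (2 * B + E0) * I0 * d := by
    have : E0 * d ≤ E0 := mul_le_of_le_one_right hE00 hd1
    calc (E0 * d) * (2 * B + E0 * d) * I0 ≤ (E0 * d) * (2 * B + E0) * I0 := by gcongr
      _ = _ := by ring
  have hb1 := (BB_sub_le (hJ1.iteratedDeriv α) (hJ2.iteratedDeriv β) (Dec_AiryC.iteratedDeriv α)
    (Dec_AiryC.iteratedDeriv β) (by positivity) hB0 (hsubα (n + 1) (Or.inl rfl)) (hsubβ n (Or.inr rfl))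
    hAα hAβ).trans hδ
  have hb2 := (BB_sub_le (hJ2.iteratedDeriv α) (hJ1.iteratedDeriv β) (Dec_AiryC.iteratedDeriv α)
    (Dec_AiryC.iteratedDeriv β) (by positivity) hB0 (hsubα n (Or.inr rfl)) (hsubβ (n + 1) (Or.inl rfl))
    hAα hAβ).trans hδ
  have hb3 : ‖BB (iteratedDeriv α AiryC) (iteratedDeriv β AiryC) (c * t) (c * s)‖ ≤ |B3| * I0 := by
    refine BB_norm_le fun l hl => (hB3 _ _ ht hs l hl).trans ?_
    gcongr
    exact le_abs_self _
  have hTT := TT_bound (c := c) hQ0 hQ1 hQd' hb1 hb2 hb3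
  rw [norm_mul, norm_mul, norm_pow, norm_pow]
  calc _ ≤ ‖c‖ ^ β * (‖c‖ ^ α * (‖c‖ * (E0 * (2 * B + E0) * I0 * d + d * (|B3| * I0)))) := by gcongr
    _ = (‖c‖ ^ β * (‖c‖ ^ α * (‖c‖ * (E0 * (2 * B + E0) * I0 + |B3| * I0)))) * d := by ring
    _ ≤ _ := by gcongr; linarith

/-- Edge asymptotics of the Christoffel–Darboux kernel: with `ℏ = μ/N`, the rescaled
kernel `ℏ^{2/3} K_N(√(2μ)+ℏ^{2/3}t, √(2μ)+ℏ^{2/3}s)` and its first complex derivatives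
converge to the Airy kernel `c_μ K_Ai(c_μ t, c_μ s)` at rate `O(ℏ^{1/3})`, uniformly
over compact subsets of `ℂ²`. -/
theorem edge_asymptotics_CD_kernel (μ : ℝ) (hμ : 0 < μ)
    (W : Set (ℂ × ℂ)) (hW : IsCompact W) (α β : ℕ) (hα : α ≤ 1) (hβ : β ≤ 1) :
    ∃ C > 0, ∀ N : ℕ, 1 ≤ N → ∀ ts ∈ W,
      ‖iteratedDeriv α (fun t =>
          iteratedDeriv β (fun s =>
            ((((μ/N) ^ ((2:ℝ)/3) : ℝ)) : ℂ) *
              KerKC (μ/N) N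
                ((Real.sqrt (2*μ) : ℂ) + ((((μ/N) ^ ((2:ℝ)/3) : ℝ)) : ℂ) * t)
                ((Real.sqrt (2*μ) : ℂ) + ((((μ/N) ^ ((2:ℝ)/3) : ℝ)) : ℂ) * s)
            - ((cEdge μ : ℝ) : ℂ) *
                KAiryC (((cEdge μ : ℝ) : ℂ) * t) (((cEdge μ : ℝ) : ℂ) * s)) ts.2) ts.1‖
        ≤ C * ((μ/N) ^ ((1:ℝ)/3)) := by
  set m := μ ^ ((1:ℝ) / 6) with hm'
  have hm : 0 < m := Real.rpow_pos_of_pos hμ _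
  have hm6 : m ^ 6 = μ := by
    rw [hm', ← Real.rpow_natCast, ← Real.rpow_mul hμ.le]; norm_num
  obtain ⟨R0, hR0⟩ := hW.isBounded.exists_norm_le
  obtain ⟨C, hC, hmain⟩ := edge_main m hm (‖((Real.sqrt 2 * m : ℝ) : ℂ)‖ * R0) α β
  refine ⟨C / m ^ 2, by positivity, fun N hN ts hts => ?_⟩
  obtain ⟨n, rfl⟩ : ∃ n, N = n + 1 := ⟨N - 1, by omega⟩
  have hNpos : (0:ℝ) < ((n + 1 : ℕ) : ℝ) := by positivity
  set q := ((n + 1 : ℕ) : ℝ) ^ ((1:ℝ) / 6) with hq'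
  have hq : 0 < q := Real.rpow_pos_of_pos hNpos _
  have hq6 : q ^ 6 = ((n + 1 : ℕ) : ℝ) := by
    rw [hq', ← Real.rpow_natCast, ← Real.rpow_mul hNpos.le]; norm_num
  have hq1 : 1 ≤ q := by
    apply Real.one_le_rpow _ (by norm_num)
    exact_mod_cast hN
  have hρ : 0 < m / q := by positivity
  have hh : μ / ((n + 1 : ℕ) : ℝ) = (m / q) ^ 6 := by rw [div_pow, hm6, hq6]
  have hh2 : ((m / q) ^ 6) ^ ((2:ℝ) / 3) = (m / q) ^ 4 := by
    rw [← Real.rpow_natCast, ← Real.rpow_mul hρ.le, ← Real.rpow_natCast]; norm_num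
  have hh1 : ((m / q) ^ 6) ^ ((1:ℝ) / 3) = (m / q) ^ 2 := by
    rw [← Real.rpow_natCast, ← Real.rpow_mul hρ.le, ← Real.rpow_natCast]; norm_num
  have hsq : Real.sqrt (2 * μ) = Real.sqrt 2 * m ^ 3 := by
    rw [Real.sqrt_mul (by norm_num), ← hm6, show m ^ 6 = (m ^ 3) ^ 2 by ring, Real.sqrt_sq (by positivity)]
  have hce : cEdge μ = Real.sqrt 2 * m := rfl
  have hdq : 1 / q ^ 2 * q ^ 2 = 1 := by field_simp
  rw [hh, hh2, hh1, hsq, hce]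
  simp only [ker_eq_TT m q hm hq (1 / q ^ 2) hdq n hq6.symm]
  have hts' := hR0 ts hts
  have h1 : ‖ts.1‖ ≤ R0 := (norm_fst_le ts).trans hts'
  have h2 : ‖ts.2‖ ≤ R0 := (norm_snd_le ts).trans hts'
  refine (hmain n q (1 / q ^ 2) hq (by positivity) ?_ hdq hq6.symm ts.1 ts.2 ?_ ?_).trans (le_of_eq ?_)
  · rw [div_le_one (by positivity)]; exact one_le_pow₀ hq1
  · rw [norm_mul]; gcongr
  · rw [norm_mul]; gcongr
  · field_simp
end

section
/- Fix ℏ > 0 and an integer N ≥ 1. Then: (i) sup_{y ∈ ℝ} ∫_ℝ ℏ |K_N(x − ℏy/2, x + ℏy/2)| dx ≤ ℏN; (ii) sup_{y ∈ ℝ} ∫_ℝ ℏ |Q_N(x − ℏy/2, x + ℏy/2)| dx ≤ √2 (ℏN)^{3/2}; and (iii) sup_{y ∈ ℝ} (ℏ/2) √(ℏN/2) ∫_ℝ | ψ_N^ℏ(x − ℏy/2) ψ_{N−1}^ℏ(x + ℏy/2) − ψ_{N−1}^ℏ(x − ℏy/2) ψ_N^ℏ(x + ℏy/2) | dx ≤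 ℏ √(ℏN/2). In particular (iii) gives the bound ‖σ_{H_N}^ℏ − p σ_{P_{<N}}^ℏ‖_{𝒜'} ≤ ℏ √(ℏN/2), where ‖h‖_{𝒜'} = (1/2π) sup_y ∫_ℝ |F₂h(x,y)| dx with F₂h(x,y) = ∫_ℝ h(x,p) e^{−ipy} dp. -/
open MeasureTheory Filter

open Polynomial in
/-- Physicists' Hermite polynomials by recursion. -/
noncomputable def Hp : ℕ → ℝ[X]
  | 0 => 1
  | (k+1) => C 2 * X * Hp k - derivative (Hp k)

open Polynomial in
lemma Hp_deriv (k : ℕ) : derivative (Hp (k+1)) = C (2*((k:ℝ)+1)) * Hp k := by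
  induction k with
  | zero => simp [Hp]
  | succ k ih =>
    rw [Hp, derivative_sub, derivative_mul, ih]
    simp only [derivative_mul, derivative_C, derivative_X]
    have : Hp (k+1) = C 2 * X * Hp k - derivative (Hp k) := rfl
    have h2 : derivative (Hp k) = C 2 * X * Hp k - Hp (k+1) := by rw [this]; ring
    rw [h2]
    simp only [map_mul, map_add, map_ofNat, Nat.cast_add, Nat.cast_one, map_one]
    ring

lemma iter_gauss (k : ℕ) : iteratedDeriv k (fun t : ℝ => Real.exp (-t^2)) =
    fun y => (-1)^k * (Hp k).eval y * Real.exp (-y^2) := by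
  induction k with
  | zero => funext y; simp [Hp]
  | succ k ih =>
    rw [iteratedDeriv_succ, ih]
    funext y
    have h1 : HasDerivAt (fun y : ℝ => Real.exp (-y^2)) (Real.exp (-y^2) * (-(2*y))) y := by
      have := ((hasDerivAt_pow 2 y).neg).exp
      simpa using this
    have h2 := (((Hp k).hasDerivAt y).const_mul ((-1:ℝ)^k)).mul h1
    refine (h2.congr_deriv ?_).deriv
    simp [Hp]
    ring

lemma hermiteH_eq (k : ℕ) (y : ℝ) : hermiteH k y = (Hp k).eval y := by
  rw [hermiteH, iter_gauss]
  have : Real.exp (y^2) * Real.exp (-y^2) = 1 := by rw [← Real.exp_add]; simp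
  have h2 : ((-1:ℝ)^k) * (-1)^k = 1 := by rw [← mul_pow]; simp
  calc _ = ((-1:ℝ)^k * (-1)^k) * (Real.exp (y^2) * Real.exp (-y^2)) * (Hp k).eval y := by ring
    _ = _ := by rw [this, h2]; ring

/-- normalisation constant -/
noncomputable def cN (hbar : ℝ) (k : ℕ) : ℝ :=
  (Real.sqrt (Real.sqrt Real.pi * 2^k * (Nat.factorial k) * Real.sqrt hbar))⁻¹

lemma cN_succ (hbar : ℝ) (k : ℕ) :
    cN hbar k = Real.sqrt (2*((k:ℝ)+1)) * cN hbar (k+1) := by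
  unfold cN
  have h : Real.sqrt Real.pi * 2^(k+1) * ((Nat.factorial (k+1) : ℕ):ℝ) * Real.sqrt hbar
      = (2*((k:ℝ)+1)) * (Real.sqrt Real.pi * 2^k * (Nat.factorial k) * Real.sqrt hbar) := by
    rw [Nat.factorial_succ]; push_cast; ring
  rw [h, Real.sqrt_mul (x := 2*((k:ℝ)+1)) (by positivity), mul_inv, ← mul_assoc, mul_inv_cancel₀ (by positivity),
    one_mul]

lemma psiH_eq (hbar : ℝ) (k : ℕ) (x : ℝ) : psiH hbar k x =
    cN hbar k * Real.exp (-x^2/(2*hbar)) * (Hp k).eval (x / Real.sqrt hbar) := by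
  rw [psiH, hermiteH_eq, cN]

lemma psiH_hasDerivAt (hbar : ℝ) (hh : 0 < hbar) (k : ℕ) (x : ℝ) :
    HasDerivAt (psiH hbar k) (-x/hbar * psiH hbar k x + cN hbar k * Real.exp (-x^2/(2*hbar)) *
      ((Polynomial.derivative (Hp k)).eval (x / Real.sqrt hbar) / Real.sqrt hbar)) x := by
  have h0 : psiH hbar k = fun x => cN hbar k * Real.exp (-x^2/(2*hbar)) *
      (Hp k).eval (x / Real.sqrt hbar) := by funext x; exact psiH_eq hbar k x
  rw [h0]
  have h1 : HasDerivAt (fun y : ℝ => Real.exp (-y^2/(2*hbar)))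
      (Real.exp (-x^2/(2*hbar)) * (-(2*x)/(2*hbar))) x := by
    have := (((hasDerivAt_pow 2 x).neg).div_const (2*hbar)).exp
    simpa using this
  have h2 : HasDerivAt (fun y : ℝ => (Hp k).eval (y / Real.sqrt hbar))
      ((Polynomial.derivative (Hp k)).eval (x / Real.sqrt hbar) * (1 / Real.sqrt hbar)) x :=
    HasDerivAt.comp (h := fun y : ℝ => y / Real.sqrt hbar) x
      ((Hp k).hasDerivAt (x / Real.sqrt hbar))
      ((hasDerivAt_id' x).div_const (Real.sqrt hbar))
  refine ((h1.const_mul (cN hbar k)).mul h2).congr_deriv ?_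
  field_simp

lemma psiH_raise (hbar : ℝ) (hh : 0 < hbar) (k : ℕ) (x : ℝ) :
    HasDerivAt (psiH hbar k) (x/hbar * psiH hbar k x
      - Real.sqrt (2*((k:ℝ)+1)) / Real.sqrt hbar * psiH hbar (k+1) x) x := by
  refine (psiH_hasDerivAt hbar hh k x).congr_deriv ?_
  rw [psiH_eq, psiH_eq hbar (k+1), cN_succ hbar k]
  have : Hp (k+1) = Polynomial.C 2 * Polynomial.X * Hp k - Polynomial.derivative (Hp k) := rfl
  rw [this]
  simp only [Polynomial.eval_sub, Polynomial.eval_mul, Polynomial.eval_C, Polynomial.eval_X]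
  have hs : Real.sqrt hbar ≠ 0 := by positivity
  have hsq : hbar = Real.sqrt hbar * Real.sqrt hbar := (Real.mul_self_sqrt hh.le).symm
  generalize Real.exp (-x^2/(2*hbar)) = E
  generalize Real.sqrt (2*((k:ℝ)+1)) = r
  generalize cN hbar (k+1) = c
  generalize (Polynomial.eval (x / Real.sqrt hbar) (Hp k)) = u
  generalize (Polynomial.eval (x / Real.sqrt hbar) (Polynomial.derivative (Hp k))) = v
  have h3 : x / hbar = x / Real.sqrt hbar / Real.sqrt hbar := by
    rw [div_div, ← hsq]
  rw [neg_div, h3]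
  field_simp
  ring

lemma psiH_lower (hbar : ℝ) (hh : 0 < hbar) (k : ℕ) (x : ℝ) :
    HasDerivAt (psiH hbar (k+1)) (-x/hbar * psiH hbar (k+1) x
      + Real.sqrt (2*((k:ℝ)+1)) / Real.sqrt hbar * psiH hbar k x) x := by
  refine (psiH_hasDerivAt hbar hh (k+1) x).congr_deriv ?_
  rw [psiH_eq hbar k, Hp_deriv, cN_succ hbar k]
  simp only [Polynomial.eval_mul, Polynomial.eval_C]
  have hr : Real.sqrt (2*((k:ℝ)+1)) * Real.sqrt (2*((k:ℝ)+1)) = 2*((k:ℝ)+1) :=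
    Real.mul_self_sqrt (by positivity)
  conv_lhs => rw [← hr]
  ring

lemma psiH_lower_zero (hbar : ℝ) (hh : 0 < hbar) (x : ℝ) :
    HasDerivAt (psiH hbar 0) (-x/hbar * psiH hbar 0 x) x := by
  refine (psiH_hasDerivAt hbar hh 0 x).congr_deriv ?_
  simp [Hp]

/-- coefficients of the ladder relations -/
noncomputable def lad (hbar : ℝ) (k : ℕ) : ℝ := Real.sqrt (2*((k:ℝ)+1)) / Real.sqrt hbar

lemma psiH_deriv_zero (hbar : ℝ) (hh : 0 < hbar) (x : ℝ) :
    HasDerivAt (psiH hbar 0) (1/2 * (- lad hbar 0 * psiH hbar 1 x)) x := by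
  have h1 := psiH_lower_zero hbar hh x
  have h2 := psiH_raise hbar hh 0 x
  refine h1.congr_deriv ?_
  have := h1.unique h2
  unfold lad
  rw [zero_add] at this
  rw [neg_div] at *
  linarith

lemma psiH_deriv_succ (hbar : ℝ) (hh : 0 < hbar) (k : ℕ) (x : ℝ) :
    HasDerivAt (psiH hbar (k+1))
      (1/2 * (lad hbar k * psiH hbar k x - lad hbar (k+1) * psiH hbar (k+2) x)) x := by
  have h1 := psiH_lower hbar hh k x
  have h2 := psiH_raise hbar hh (k+1) x
  refine h1.congr_deriv ?_
  have := h1.unique h2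
  unfold lad
  rw [neg_div] at *
  rw [show k+1+1 = k+2 from rfl] at this
  linarith

open Polynomial in
/-- polynomial times Gaussian -/
noncomputable def GP (b : ℝ) (P : ℝ[X]) (y : ℝ) : ℝ := P.eval y * Real.exp (-b*y^2)

open Polynomial in
lemma GP_integrable {b : ℝ} (hb : 0 < b) (P : ℝ[X]) : Integrable (GP b P) := by
  unfold GP
  induction P using Polynomial.induction_on' with
  | add p q hp hq =>
    refine (hp.add hq).congr (Eventually.of_forall fun y => ?_)
    simp [add_mul]
  | monomial n a =>
    have := (integrable_rpow_mul_exp_neg_mul_sq hb (s := n)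
      (by have : (0:ℝ) ≤ n := by positivity
          linarith)).const_mul a
    simpa [mul_assoc] using this

open Polynomial in
lemma GP_hasDerivAt (b : ℝ) (P : ℝ[X]) (y : ℝ) :
    HasDerivAt (GP b P) (GP b (derivative P - C (2*b) * X * P) y) y := by
  unfold GP
  have h1 : HasDerivAt (fun y : ℝ => Real.exp (-b*y^2))
      (Real.exp (-b*y^2) * (-b*(2*y))) y := by
    have := ((hasDerivAt_pow 2 y).const_mul (-b)).exp
    simpa using this
  refine ((P.hasDerivAt y).mul h1).congr_deriv ?_
  simp
  ring

open Polynomial in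
lemma psi_poly (hbar : ℝ) (k : ℕ) : ∃ P : ℝ[X], ∀ x, psiH hbar k x =
    P.eval x * Real.exp (-x^2/(2*hbar)) := by
  refine ⟨C (cN hbar k) * (Hp k).comp (C (1/Real.sqrt hbar) * X), fun x => ?_⟩
  rw [psiH_eq]
  simp only [eval_mul, eval_C, eval_comp, eval_X]
  rw [show 1 / Real.sqrt hbar * x = x / Real.sqrt hbar by ring]
  ring

lemma psi_mul_GP (hbar : ℝ) (hh : 0 < hbar) (j k : ℕ) : ∃ P : Polynomial ℝ,
    (fun x => psiH hbar j x * psiH hbar k x) = GP (1/hbar) P := by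
  obtain ⟨P, hP⟩ := psi_poly hbar j
  obtain ⟨Q, hQ⟩ := psi_poly hbar k
  refine ⟨P * Q, ?_⟩
  funext x
  rw [hP, hQ, GP, Polynomial.eval_mul]
  have : Real.exp (-(1/hbar)*x^2) = Real.exp (-x^2/(2*hbar)) * Real.exp (-x^2/(2*hbar)) := by
    rw [← Real.exp_add]; congr 1; field_simp; ring
  rw [this]; ring

lemma psi_wig_GP (hbar : ℝ) (hh : 0 < hbar) (j k : ℕ) (x : ℝ) : ∃ P : Polynomial ℝ,
    (fun y => psiH hbar j (x - hbar*y/2) * psiH hbar k (x + hbar*y/2)) = GP (hbar/4) P := by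
  obtain ⟨P, hP⟩ := psi_poly hbar j
  obtain ⟨Q, hQ⟩ := psi_poly hbar k
  open Polynomial in
  refine ⟨C (Real.exp (-x^2/hbar)) * (P.comp (C x - C (hbar/2) * X) *
    Q.comp (C x + C (hbar/2) * X)), ?_⟩
  funext y
  rw [hP, hQ, GP]
  have : Real.exp (-x^2/hbar) * Real.exp (-(hbar/4)*y^2)
      = Real.exp (-(x - hbar*y/2)^2/(2*hbar)) * Real.exp (-(x+hbar*y/2)^2/(2*hbar)) := by
    rw [← Real.exp_add, ← Real.exp_add]; congr 1; field_simp; ring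
  simp only [Polynomial.eval_mul, Polynomial.eval_C, Polynomial.eval_comp, Polynomial.eval_X,
    Polynomial.eval_add, Polynomial.eval_sub]
  rw [show hbar/2*y = hbar*y/2 by ring]
  linear_combination (-Polynomial.eval (x - hbar*y/2) P * Polynomial.eval (x + hbar*y/2) Q) * this

lemma psi_mul_integrable (hbar : ℝ) (hh : 0 < hbar) (j k : ℕ) :
    Integrable (fun x => psiH hbar j x * psiH hbar k x) := by
  obtain ⟨P, hP⟩ := psi_mul_GP hbar hh j k
  rw [hP]; exact GP_integrable (by positivity) P

lemma psi_sq_integrable (hbar : ℝ) (hh : 0 < hbar) (k : ℕ) :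
    Integrable (fun x => psiH hbar k x ^ 2) := by
  simpa [sq] using psi_mul_integrable hbar hh k k

lemma psi_norm (hbar : ℝ) (hh : 0 < hbar) (k : ℕ) : ∫ x, psiH hbar k x ^ 2 = 1 := by
  induction k with
  | zero =>
    have : ∀ x, psiH hbar 0 x ^ 2 = (Real.sqrt Real.pi * Real.sqrt hbar)⁻¹ *
        Real.exp (-(1/hbar) * x^2) := by
      intro x
      rw [psiH_eq, cN]
      simp only [pow_zero, Nat.factorial_zero, Nat.cast_one, mul_one, Hp, Polynomial.eval_one]
      rw [mul_pow, inv_pow, Real.sq_sqrt (by positivity), ← Real.exp_nat_mul]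
      congr 2; push_cast; field_simp
    simp_rw [this]
    rw [integral_const_mul, integral_gaussian, ← Real.sqrt_mul (by positivity)]
    rw [show Real.pi / (1/hbar) = Real.pi * hbar by field_simp]
    exact inv_mul_cancel₀ (by positivity)
  | succ k ih =>
    have hd : ∀ x, HasDerivAt (fun x => psiH hbar (k+1) x * psiH hbar k x)
        (lad hbar k * (psiH hbar k x ^ 2 - psiH hbar (k+1) x ^ 2)) x := by
      intro x
      refine ((psiH_lower hbar hh k x).mul (psiH_raise hbar hh k x)).congr_deriv ?_
      unfold lad
      ring
    have hi := (psi_sq_integrable hbar hh k).sub (psi_sq_integrable hbar hh (k+1))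
    have h0 := integral_eq_zero_of_hasDerivAt_of_integrable hd (hi.const_mul _)
      (psi_mul_integrable hbar hh (k+1) k)
    rw [integral_const_mul, integral_sub (psi_sq_integrable hbar hh k)
      (psi_sq_integrable hbar hh (k+1)), ih] at h0
    have hl : lad hbar k ≠ 0 := by unfold lad; positivity
    have := (mul_eq_zero.mp h0).resolve_left hl
    linarith

lemma psi_cont (hbar : ℝ) (hh : 0 < hbar) (k : ℕ) : Continuous (psiH hbar k) :=
  continuous_iff_continuousAt.2 fun x => (psiH_raise hbar hh k x).continuousAt

lemma prod_integrable (hbar : ℝ) (hh : 0 < hbar) (j k : ℕ) (a : ℝ) :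
    Integrable (fun x => |psiH hbar j (x - a) * psiH hbar k (x + a)|) ∧
    (∫ x, |psiH hbar j (x - a) * psiH hbar k (x + a)|) ≤ 1 := by
  have h1 := (psi_sq_integrable hbar hh j).comp_sub_right a
  have h2 := (psi_sq_integrable hbar hh k).comp_add_right a
  have h3 := (h1.add h2).const_mul (1/2)
  have hb : ∀ x, |psiH hbar j (x - a) * psiH hbar k (x + a)| ≤
      1/2 * (psiH hbar j (x-a)^2 + psiH hbar k (x+a)^2) := by
    intro x
    rw [abs_le]
    constructor
    · nlinarith [sq_nonneg (psiH hbar j (x-a) + psiH hbar k (x+a))]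
    · nlinarith [sq_nonneg (psiH hbar j (x-a) - psiH hbar k (x+a))]
  have hint : Integrable (fun x => |psiH hbar j (x - a) * psiH hbar k (x + a)|) := by
    refine h3.mono' ?_ (Eventually.of_forall fun x => ?_)
    · have := psi_cont hbar hh j
      have := psi_cont hbar hh k
      exact Continuous.aestronglyMeasurable (by fun_prop)
    · rw [Real.norm_eq_abs, abs_abs]; exact hb x
  refine ⟨hint, (integral_mono hint h3 hb).trans ?_⟩
  have e1 : ∫ x, psiH hbar j (x-a)^2 = 1 := by
    rw [integral_sub_right_eq_self (fun x => psiH hbar j x^2), psi_norm hbar hh]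
  have e2 : ∫ x, psiH hbar k (x+a)^2 = 1 := by
    rw [integral_add_right_eq_self (fun x => psiH hbar k x^2), psi_norm hbar hh]
  have := integral_add h1 h2
  simp only [Pi.add_apply]
  rw [integral_const_mul, this, e1, e2]; norm_num

lemma diff_integrable (hbar : ℝ) (hh : 0 < hbar) (j k : ℕ) (a : ℝ) :
    Integrable (fun x => |psiH hbar j (x - a) * psiH hbar k (x + a)
      - psiH hbar k (x - a) * psiH hbar j (x + a)|) ∧
    (∫ x, |psiH hbar j (x - a) * psiH hbar k (x + a)
      - psiH hbar k (x - a) * psiH hbar j (x + a)|) ≤ 2 := by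
  obtain ⟨h1, h1'⟩ := prod_integrable hbar hh j k a
  obtain ⟨h2, h2'⟩ := prod_integrable hbar hh k j a
  have hb : ∀ x, |psiH hbar j (x - a) * psiH hbar k (x + a)
      - psiH hbar k (x - a) * psiH hbar j (x + a)| ≤
      |psiH hbar j (x - a) * psiH hbar k (x + a)| + |psiH hbar k (x - a) * psiH hbar j (x + a)| :=
    fun x => abs_sub _ _
  have hint : Integrable (fun x => |psiH hbar j (x - a) * psiH hbar k (x + a)
      - psiH hbar k (x - a) * psiH hbar j (x + a)|) := by
    refine (h1.add h2).mono' ?_ (Eventually.of_forall fun x => ?_)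
    · have := psi_cont hbar hh j
      have := psi_cont hbar hh k
      exact Continuous.aestronglyMeasurable (by fun_prop)
    · rw [Real.norm_eq_abs, abs_abs]; exact hb x
  refine ⟨hint, (integral_mono hint (h1.add h2) hb).trans ?_⟩
  have := integral_add h1 h2
  simp only [Pi.add_apply]
  rw [this]; linarith

/-- Fourier integral with the sign and normalisation of the Weyl symbols. -/
noncomputable def Four (f : ℝ → ℝ) (p : ℝ) : ℂ :=
  ∫ y : ℝ, (f y : ℂ) * Complex.exp (Complex.I * (p:ℂ) * (y:ℂ))

lemma norm_char (p y : ℝ) : ‖Complex.exp (Complex.I * (p:ℂ) * (y:ℂ))‖ = 1 := by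
  rw [mul_assoc, mul_comm, ← Complex.ofReal_mul]
  exact Complex.norm_exp_ofReal_mul_I _

lemma four_integrable {f : ℝ → ℝ} (hf : Integrable f) (p : ℝ) :
    Integrable (fun y : ℝ => (f y : ℂ) * Complex.exp (Complex.I * (p:ℂ) * (y:ℂ))) := by
  refine hf.ofReal.mul_bdd (c := 1) ?_ (Eventually.of_forall fun y => (norm_char p y).le)
  exact Continuous.aestronglyMeasurable (by fun_prop)

lemma four_bound (f : ℝ → ℝ) (p : ℝ) : ‖Four f p‖ ≤ ∫ y, |f y| := by
  refine (norm_integral_le_integral_norm _).trans (le_of_eq ?_)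
  congr 1; funext y
  rw [norm_mul, norm_char, mul_one, Complex.norm_real, Real.norm_eq_abs]

lemma four_parts {f f' : ℝ → ℝ} (hd : ∀ y, HasDerivAt f (f' y) y) (hf : Integrable f)
    (hf' : Integrable f') (p : ℝ) : (p:ℂ) * Four f p = Complex.I * Four f' p := by
  have hE : ∀ y : ℝ, HasDerivAt (fun y : ℝ => Complex.exp (Complex.I * (p:ℂ) * (y:ℂ)))
      (Complex.exp (Complex.I * (p:ℂ) * (y:ℂ)) * (Complex.I * (p:ℂ))) y := by
    intro y
    have := ((Complex.ofRealCLM.hasDerivAt (x := y)).const_mul (Complex.I * (p:ℂ))).cexp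
    simpa using this
  have hF : ∀ y : ℝ, HasDerivAt (fun y : ℝ => (f y : ℂ) * Complex.exp (Complex.I * (p:ℂ) * (y:ℂ)))
      ((f' y : ℂ) * Complex.exp (Complex.I * (p:ℂ) * (y:ℂ)) +
        (Complex.I * (p:ℂ)) * ((f y : ℂ) * Complex.exp (Complex.I * (p:ℂ) * (y:ℂ)))) y := by
    intro y
    refine ((hd y).ofReal_comp.mul (hE y)).congr_deriv ?_
    ring
  have h1 := four_integrable hf p
  have h2 := four_integrable hf' p
  have h0 := integral_eq_zero_of_hasDerivAt_of_integrable hF (h2.add (h1.const_mul _)) h1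
  rw [integral_add h2 (h1.const_mul _), integral_const_mul] at h0
  change Four f' p + Complex.I * (p:ℂ) * Four f p = 0 at h0
  have hI := Complex.I_mul_I
  linear_combination (-Complex.I) * h0 + (p:ℂ) * Four f p * hI

open FourierTransform in
lemma four_fourierInv (f : ℝ → ℝ) (w : ℝ) :
    𝓕⁻ (fun y => (f y : ℂ)) w = Four f (2*Real.pi*w) := by
  rw [Real.fourierInv_eq', Four]
  congr 1; funext y
  rw [smul_eq_mul, mul_comm]
  congr 2
  simp
  ring

open FourierTransform in
lemma four_fourier (f : ℝ → ℝ) (w : ℝ) :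
    𝓕 (fun y => (f y : ℂ)) w = Four f (-(2*Real.pi)*w) := by
  rw [Real.fourier_eq', Four]
  congr 1; funext y
  rw [smul_eq_mul, mul_comm]
  congr 2
  simp
  ring

lemma four_continuous {f : ℝ → ℝ} (hf : Integrable f) : Continuous (Four f) := by
  refine continuous_of_dominated (bound := fun y => |f y|) (fun p => (four_integrable hf p).1)
    (fun p => Eventually.of_forall fun y => ?_) hf.abs (Eventually.of_forall fun y => ?_)
  · rw [norm_mul, norm_char, mul_one, Complex.norm_real, Real.norm_eq_abs]
  · fun_prop

lemma four_GP_integrable {b : ℝ} (hb : 0 < b) (P : Polynomial ℝ) : Integrable (Four (GP b P)) := by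
  obtain ⟨P1, h1⟩ : ∃ P1, ∀ y, HasDerivAt (GP b P) (GP b P1 y) y := ⟨_, GP_hasDerivAt b P⟩
  obtain ⟨P2, h2⟩ : ∃ P2, ∀ y, HasDerivAt (GP b P1) (GP b P2 y) y := ⟨_, GP_hasDerivAt b P1⟩
  have i0 := GP_integrable hb P
  have i1 := GP_integrable hb P1
  have i2 := GP_integrable hb P2
  refine (integrable_inv_one_add_sq.mul_const ((∫ y, |GP b P y|) + ∫ y, |GP b P2 y|)).mono'
    (four_continuous i0).aestronglyMeasurable (Eventually.of_forall fun p => ?_)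
  have e1 := four_parts h1 i0 i1 p
  have e2 := four_parts h2 i1 i2 p
  have e3 : (p:ℂ)^2 * Four (GP b P) p = - Four (GP b P2) p := by
    linear_combination (p:ℂ) * e1 + Complex.I * e2 + Four (GP b P2) p * Complex.I_mul_I
  have e4 : p^2 * ‖Four (GP b P) p‖ = ‖Four (GP b P2) p‖ := by
    have := congrArg norm e3
    rw [norm_neg, norm_mul, norm_pow, Complex.norm_real, Real.norm_eq_abs, sq_abs] at this
    exact this
  have b0 := four_bound (GP b P) p
  have b2 := four_bound (GP b P2) p
  rw [inv_mul_eq_div, le_div_iff₀ (by positivity)]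
  nlinarith

open FourierTransform in
lemma four_inversion {b : ℝ} (hb : 0 < b) (P : Polynomial ℝ) (y : ℝ) :
    ∫ p : ℝ, Four (GP b P) p * Complex.exp (-(Complex.I * (p:ℂ) * (y:ℂ))) =
      2 * Real.pi * (GP b P y : ℂ) := by
  have i0 := GP_integrable hb P
  have hc : Continuous (fun y => (GP b P y : ℂ)) := by
    unfold GP; fun_prop
  have hF : Integrable (𝓕 (fun y => (GP b P y : ℂ))) := by
    have : 𝓕 (fun y => (GP b P y : ℂ)) = fun w => Four (GP b P) (-(2*Real.pi)*w) := by
      funext w; exact four_fourier _ w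
    rw [this]
    exact (four_GP_integrable hb P).comp_mul_left' (by have := Real.pi_pos; simp)
  have key := congrFun (hc.fourier_fourierInv_eq i0.ofReal hF) y
  rw [Real.fourier_eq'] at key
  have e : ∀ v : ℝ, Complex.exp (((-2 * Real.pi * inner ℝ v y : ℝ) : ℂ) * Complex.I) •
      𝓕⁻ (fun y => (GP b P y : ℂ)) v = (fun p : ℝ => Four (GP b P) p *
        Complex.exp (-(Complex.I * (p:ℂ) * (y:ℂ)))) ((2*Real.pi) * v) := by
    intro v
    rw [four_fourierInv, smul_eq_mul, mul_comm]
    simp only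
    congr 2
    simp
    ring
  rw [integral_congr_ae (Eventually.of_forall e)] at key
  rw [Measure.integral_comp_mul_left (fun p : ℝ => Four (GP b P) p *
        Complex.exp (-(Complex.I * (p:ℂ) * (y:ℂ))))] at key
  rw [← key, abs_of_pos (by positivity), Complex.real_smul]
  have := Complex.ofReal_ne_zero.2 Real.pi_ne_zero
  push_cast
  generalize (∫ p : ℝ, Four (GP b P) p * Complex.exp (-(Complex.I * (p:ℂ) * (y:ℂ)))) = Z
  field_simp

/-- antisymmetrised product of neighbouring Hermite functions -/
noncomputable def AA (hbar : ℝ) (j : ℕ) (u v : ℝ) : ℝ :=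
  psiH hbar (j+1) u * psiH hbar j v - psiH hbar j u * psiH hbar (j+1) v

/-- real version of `KerQ` -/
noncomputable def QR (hbar : ℝ) (N : ℕ) (u v : ℝ) : ℝ :=
  Real.sqrt (hbar/2) * ∑ j ∈ Finset.range (N-1), Real.sqrt ((j:ℝ)+1) * AA hbar j u v

lemma KerQ_eq (hbar : ℝ) (N : ℕ) (u v : ℝ) : KerQ hbar N u v = Complex.I * (QR hbar N u v : ℂ) := by
  unfold KerQ QR AA
  push_cast
  ring

lemma lad_eq (hbar : ℝ) (hh : 0 < hbar) (k : ℕ) :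
    hbar / 2 * lad hbar k = Real.sqrt (hbar/2) * Real.sqrt ((k:ℝ)+1) := by
  unfold lad
  rw [Real.sqrt_mul (by norm_num), Real.sqrt_div hh.le]
  have h1 : Real.sqrt hbar * Real.sqrt hbar = hbar := Real.mul_self_sqrt hh.le
  have h2 : Real.sqrt 2 * Real.sqrt 2 = 2 := Real.mul_self_sqrt (by norm_num)
  have : 0 < Real.sqrt hbar := by positivity
  field_simp
  rw [sq, sq, h1, h2]
  ring

lemma wig_deriv {f g : ℝ → ℝ} {f' g' : ℝ → ℝ} (hf : ∀ x, HasDerivAt f (f' x) x)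
    (hg : ∀ x, HasDerivAt g (g' x) x) (hbar x y : ℝ) :
    HasDerivAt (fun y => f (x - hbar*y/2) * g (x + hbar*y/2))
      (hbar/2 * (f (x - hbar*y/2) * g' (x + hbar*y/2) - f' (x - hbar*y/2) * g (x + hbar*y/2))) y := by
  have l : HasDerivAt (fun y : ℝ => hbar*y/2) (hbar/2) y := by
    simpa using ((hasDerivAt_id' y).const_mul hbar).div_const 2
  have h1 := (hf (x - hbar*y/2)).comp (h := fun y : ℝ => x - hbar*y/2) y (l.const_sub x)
  have h2 := (hg (x + hbar*y/2)).comp (h := fun y : ℝ => x + hbar*y/2) y (l.const_add x)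
  refine (h1.mul h2).congr_deriv ?_
  simp only [Function.comp]
  ring

lemma KerK_deriv (hbar : ℝ) (hh : 0 < hbar) (M : ℕ) (x y : ℝ) :
    HasDerivAt (fun y => KerK hbar (M+1) (x - hbar*y/2) (x + hbar*y/2))
      (QR hbar (M+1) (x - hbar*y/2) (x + hbar*y/2) + 1/2 * (Real.sqrt (hbar/2) *
        Real.sqrt ((M:ℝ)+1) * AA hbar M (x - hbar*y/2) (x + hbar*y/2))) y := by
  induction M with
  | zero =>
    have := wig_deriv (psiH_deriv_zero hbar hh) (psiH_deriv_zero hbar hh) hbar x y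
    simp only [KerK, Finset.sum_range_succ, Finset.sum_range_zero, zero_add]
    refine this.congr_deriv ?_
    rw [← lad_eq hbar hh]
    simp only [QR, AA, Nat.sub_self, zero_add, Finset.sum_range_zero]
    ring
  | succ M ih =>
    have := wig_deriv (psiH_deriv_succ hbar hh M) (psiH_deriv_succ hbar hh M) hbar x y
    have h2 : (fun y => KerK hbar (M+1+1) (x - hbar*y/2) (x + hbar*y/2)) = fun y =>
        KerK hbar (M+1) (x - hbar*y/2) (x + hbar*y/2) +
          psiH hbar (M+1) (x - hbar*y/2) * psiH hbar (M+1) (x + hbar*y/2) := by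
      funext y
      simp only [KerK]
      rw [Finset.sum_range_succ]
    rw [h2]
    refine (ih.add this).congr_deriv ?_
    have h3 : QR hbar (M+1+1) (x - hbar*y/2) (x + hbar*y/2) =
        QR hbar (M+1) (x - hbar*y/2) (x + hbar*y/2) + hbar / 2 * lad hbar M *
          AA hbar M (x - hbar*y/2) (x + hbar*y/2) := by
      rw [lad_eq hbar hh]
      simp only [QR, Nat.add_sub_cancel]
      rw [Finset.sum_range_succ]; ring
    rw [h3, ← lad_eq hbar hh, ← lad_eq hbar hh]
    simp only [AA]
    ring

lemma AA_GP (hbar : ℝ) (hh : 0 < hbar) (j : ℕ) (x : ℝ) : ∃ P : Polynomial ℝ,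
    (fun y => AA hbar j (x - hbar*y/2) (x + hbar*y/2)) = GP (hbar/4) P := by
  obtain ⟨P, hP⟩ := psi_wig_GP hbar hh (j+1) j x
  obtain ⟨Q, hQ⟩ := psi_wig_GP hbar hh j (j+1) x
  refine ⟨P - Q, ?_⟩
  funext y
  have h1 := congrFun hP y
  have h2 := congrFun hQ y
  rw [AA, h1, h2]
  simp only [GP, Polynomial.eval_sub]
  ring

lemma symbol_diff (hbar : ℝ) (hh : 0 < hbar) (M : ℕ) (x p : ℝ) :
    sigmaH hbar (M+1) x p - (p:ℂ) * sigmaP hbar (M+1) x p =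
      -Complex.I * ((hbar/2 * (Real.sqrt (hbar/2) * Real.sqrt ((M:ℝ)+1)) : ℝ) : ℂ) *
        Four (fun y => AA hbar M (x - hbar*y/2) (x + hbar*y/2)) p := by
  have iA : ∀ j, Integrable (fun y => AA hbar j (x - hbar*y/2) (x + hbar*y/2)) := by
    intro j
    obtain ⟨P, hP⟩ := AA_GP hbar hh j x
    rw [hP]; exact GP_integrable (by positivity) P
  have iQ : Integrable (fun y => QR hbar (M+1) (x - hbar*y/2) (x + hbar*y/2)) := by
    simp only [QR]
    exact (integrable_finsetSum _ fun j _ => (iA j).const_mul _).const_mul _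
  have iK : Integrable (fun y => KerK hbar (M+1) (x - hbar*y/2) (x + hbar*y/2)) := by
    simp only [KerK]
    refine integrable_finsetSum _ fun j _ => ?_
    obtain ⟨P, hP⟩ := psi_wig_GP hbar hh j j x
    rw [hP]; exact GP_integrable (by positivity) P
  have iB := ((iA M).const_mul (Real.sqrt (hbar/2) * Real.sqrt ((M:ℝ)+1))).const_mul (1/2)
  have hp := four_parts (fun y => (KerK_deriv hbar hh M x y).const_mul hbar)
    (iK.const_mul hbar) ((iQ.add iB).const_mul hbar) p
  have eP : sigmaP hbar (M+1) x p =
    Four (fun y => hbar * KerK hbar (M+1) (x - hbar*y/2) (x + hbar*y/2)) p := rfl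
  rw [eP, hp]
  have eH : sigmaH hbar (M+1) x p = Complex.I * hbar *
      Four (fun y => QR hbar (M+1) (x - hbar*y/2) (x + hbar*y/2)) p := by
    unfold sigmaH Four
    rw [← integral_const_mul]
    congr 1; funext y
    rw [KerQ_eq]; ring
  rw [eH]
  have eS : Four (fun y => hbar * (QR hbar (M+1) (x - hbar*y/2) (x + hbar*y/2) +
      1/2 * (Real.sqrt (hbar/2) * Real.sqrt ((M:ℝ)+1) *
        AA hbar M (x - hbar*y/2) (x + hbar*y/2)))) p =
      hbar * Four (fun y => QR hbar (M+1) (x - hbar*y/2) (x + hbar*y/2)) p +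
      ((hbar/2 * (Real.sqrt (hbar/2) * Real.sqrt ((M:ℝ)+1)) : ℝ) : ℂ) *
        Four (fun y => AA hbar M (x - hbar*y/2) (x + hbar*y/2)) p := by
    unfold Four
    rw [← integral_const_mul, ← integral_const_mul, ← integral_add
      ((four_integrable iQ p).const_mul _) ((four_integrable (iA M) p).const_mul _)]
    congr 1; funext y
    push_cast
    ring
  rw [eS]
  ring

lemma inner_eq (hbar : ℝ) (hh : 0 < hbar) (M : ℕ) (x y : ℝ) :
    ‖∫ p : ℝ, (sigmaH hbar (M+1) x p - (p : ℂ) * sigmaP hbar (M+1) x p) *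
            Complex.exp (-(Complex.I * (p:ℂ) * (y:ℂ)))‖ =
    2 * Real.pi * (hbar/2 * (Real.sqrt (hbar/2) * Real.sqrt ((M:ℝ)+1))) *
      |AA hbar M (x - hbar*y/2) (x + hbar*y/2)| := by
  simp_rw [symbol_diff hbar hh M x, mul_assoc _ (Four _ _)]
  rw [integral_const_mul]
  obtain ⟨P, hP⟩ := AA_GP hbar hh M x
  have h1 := congrFun hP y
  rw [hP, four_inversion (by positivity) P y, h1]
  have hc : 0 ≤ hbar/2 * (Real.sqrt (hbar/2) * Real.sqrt ((M:ℝ)+1)) := by positivity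
  have h2pi : ‖(2 * (Real.pi:ℂ))‖ = 2 * Real.pi := by
    rw [norm_mul, Complex.norm_ofNat, Complex.norm_real, Real.norm_of_nonneg Real.pi_pos.le]
  rw [norm_mul, norm_mul, norm_mul (2 * (Real.pi:ℂ)), norm_neg, Complex.norm_I, Complex.norm_real,
    Complex.norm_real, Real.norm_of_nonneg hc, Real.norm_eq_abs, h2pi]
  ring

/-- Uniform `𝒜'`-type bounds: (i), (ii) the symbols `σ_{P_{<N}}^ℏ`, `σ_{H_N}^ℏ` are
bounded in `𝒜'`; (iii) the boundary kernel bound; and in particular (iv) the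
`𝒜'`-distance between `σ_{H_N}^ℏ` and `p·σ_{P_{<N}}^ℏ` is at most `ℏ√(ℏN/2)`. -/
theorem symbol_Aprime_bounds (hbar : ℝ) (hh : 0 < hbar) (N : ℕ) (hN : 1 ≤ N) :
    (∀ y : ℝ,
      (∫ x : ℝ, hbar * |KerK hbar N (x - hbar*y/2) (x + hbar*y/2)|) ≤ hbar * N)
    ∧ (∀ y : ℝ,
      (∫ x : ℝ, hbar * ‖KerQ hbar N (x - hbar*y/2) (x + hbar*y/2)‖)
        ≤ Real.sqrt 2 * (hbar * N) ^ ((3:ℝ)/2))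
    ∧ (∀ y : ℝ,
      (hbar / 2) * Real.sqrt (hbar * N / 2) *
        (∫ x : ℝ, |psiH hbar N (x - hbar*y/2) * psiH hbar (N-1) (x + hbar*y/2)
            - psiH hbar (N-1) (x - hbar*y/2) * psiH hbar N (x + hbar*y/2)|)
        ≤ hbar * Real.sqrt (hbar * N / 2))
    ∧ (∀ y : ℝ,
      (1 / (2 * Real.pi)) *
        (∫ x : ℝ, ‖∫ p : ℝ, (sigmaH hbar N x p - (p : ℂ) * sigmaP hbar N x p) *
            Complex.exp (-(Complex.I * (p:ℂ) * (y:ℂ)))‖)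
        ≤ hbar * Real.sqrt (hbar * N / 2)) := by
  have h3 : ∀ y : ℝ, (hbar / 2) * Real.sqrt (hbar * N / 2) *
        (∫ x : ℝ, |psiH hbar N (x - hbar*y/2) * psiH hbar (N-1) (x + hbar*y/2)
            - psiH hbar (N-1) (x - hbar*y/2) * psiH hbar N (x + hbar*y/2)|)
        ≤ hbar * Real.sqrt (hbar * N / 2) := by
    intro y
    have := (diff_integrable hbar hh N (N-1) (hbar*y/2)).2
    have := mul_le_mul_of_nonneg_left this
      (show 0 ≤ (hbar / 2) * Real.sqrt (hbar * N / 2) by positivity)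
    refine this.trans (le_of_eq ?_)
    ring
  refine ⟨fun y => ?_, fun y => ?_, h3, fun y => ?_⟩
  · rw [integral_const_mul]
    refine mul_le_mul_of_nonneg_left ?_ hh.le
    have hs : Integrable (fun x => ∑ k ∈ Finset.range N,
        |psiH hbar k (x - hbar*y/2) * psiH hbar k (x + hbar*y/2)|) :=
      integrable_finsetSum _ fun k _ => (prod_integrable hbar hh k k (hbar*y/2)).1
    refine (integral_mono_of_nonneg (Eventually.of_forall fun x => abs_nonneg _) hs
      (Eventually.of_forall fun x => Finset.abs_sum_le_sum_abs _ _)).trans ?_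
    rw [integral_finsetSum _ fun k _ => (prod_integrable hbar hh k k (hbar*y/2)).1]
    refine (Finset.sum_le_sum fun k _ => (prod_integrable hbar hh k k (hbar*y/2)).2).trans ?_
    simp
  · rw [integral_const_mul]
    have hs : Integrable (fun x => Real.sqrt (hbar/2) * ∑ j ∈ Finset.range (N-1),
        Real.sqrt ((j:ℝ)+1) * |AA hbar j (x - hbar*y/2) (x + hbar*y/2)|) :=
      (integrable_finsetSum _ fun k _ =>
        (diff_integrable hbar hh (k+1) k (hbar*y/2)).1.const_mul _).const_mul _
    have hb : (∫ x : ℝ, ‖KerQ hbar N (x - hbar*y/2) (x + hbar*y/2)‖) ≤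
        Real.sqrt (hbar/2) * (N * (Real.sqrt N * 2)) := by
      refine (integral_mono_of_nonneg (Eventually.of_forall fun x => norm_nonneg _) hs
        (Eventually.of_forall fun x => ?_)).trans ?_
      · simp only
        rw [KerQ_eq, norm_mul, Complex.norm_I, one_mul, Complex.norm_real, Real.norm_eq_abs, QR,
          abs_mul, abs_of_nonneg (Real.sqrt_nonneg _)]
        refine mul_le_mul_of_nonneg_left ?_ (Real.sqrt_nonneg _)
        refine (Finset.abs_sum_le_sum_abs _ _).trans (le_of_eq ?_)
        refine Finset.sum_congr rfl fun j _ => ?_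
        rw [abs_mul, abs_of_nonneg (Real.sqrt_nonneg _)]
      · rw [integral_const_mul]
        refine mul_le_mul_of_nonneg_left ?_ (Real.sqrt_nonneg _)
        have hi : ∀ j ∈ Finset.range (N-1), Integrable (fun x => Real.sqrt ((j:ℝ)+1) *
            |AA hbar j (x - hbar*y/2) (x + hbar*y/2)|) := fun k _ =>
          (diff_integrable hbar hh (k+1) k (hbar*y/2)).1.const_mul _
        rw [integral_finsetSum _ hi]
        have : ∀ j ∈ Finset.range (N-1), (∫ x, Real.sqrt ((j:ℝ)+1) *
            |AA hbar j (x - hbar*y/2) (x + hbar*y/2)|) ≤ Real.sqrt N * 2 := by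
          intro j hj
          rw [integral_const_mul]
          have hj' : (j:ℝ) + 1 ≤ N := by
            have := Finset.mem_range.1 hj
            have : j + 1 ≤ N := by omega
            exact_mod_cast this
          exact mul_le_mul (Real.sqrt_le_sqrt hj') (diff_integrable hbar hh (j+1) j (hbar*y/2)).2
            (integral_nonneg fun x => abs_nonneg _) (Real.sqrt_nonneg _)
        refine (Finset.sum_le_sum this).trans ?_
        rw [Finset.sum_const, Finset.card_range, nsmul_eq_mul]
        refine mul_le_mul_of_nonneg_right ?_ (by positivity)
        exact_mod_cast Nat.sub_le N 1
    refine (mul_le_mul_of_nonneg_left hb hh.le).trans (le_of_eq ?_)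
    have hNN : (0:ℝ) < hbar * N := by
      have : (0:ℝ) < N := by exact_mod_cast hN
      positivity
    rw [show (3:ℝ)/2 = 1 + 1/2 by norm_num, Real.rpow_add hNN, Real.rpow_one,
      ← Real.sqrt_eq_rpow, Real.sqrt_mul hh.le, Real.sqrt_div hh.le]
    have h2 : Real.sqrt 2 * Real.sqrt 2 = 2 := Real.mul_self_sqrt (by norm_num)
    have h2' : 0 < Real.sqrt 2 := by positivity
    field_simp
    linarith
  · obtain ⟨M, rfl⟩ : ∃ M, N = M + 1 := ⟨N - 1, by omega⟩
    simp_rw [inner_eq hbar hh M]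
    rw [integral_const_mul]
    refine le_trans (le_of_eq ?_) (h3 y)
    have hs : Real.sqrt (hbar * ((M+1 : ℕ):ℝ) / 2) =
        Real.sqrt (hbar/2) * Real.sqrt ((M:ℝ)+1) := by
      rw [← Real.sqrt_mul (by positivity)]; congr 1; push_cast; ring
    rw [hs]
    have hpi := Real.pi_ne_zero
    simp only [AA, Nat.add_sub_cancel]
    field_simp
end
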